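/- arXiv:1309.4810 — 2 statements merged into one kernel-verified Lean document; each statement's English description precedes it below -/
import Mathlib

section
/- There exists a deterministic finite automaton with output having at most 278 states, input alphabet {0,1}, and output alphabet consisting of finite subsets of ℤ³, such that for every n ≥ 1, reading the normal T-representation ⟨n⟩_T from the most significant digit, the output equals the set P^rel_t(n) of relative Parikh vectors of the factors of the Tribonacci word t of length n. In particular, the map n ↦ P^rel_t(n) takes only finitely many values. -/
/-- The m-bonacci substitution on letters. -/
def mbSub (m : ℕ) (ℓ : ℕ) : List ℕ :=
  if ℓ = m - 1 then [0] else [0, ℓ + 1]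

/-- Application of the m-bonacci substitution to a word. -/
def mbApply (m : ℕ) (w : List ℕ) : List ℕ := w.flatMap (mbSub m)

/-- σ_m^k(0). -/
def mbIter (m k : ℕ) : List ℕ := (mbApply m)^[k] [0]

/-- w is a factor of the m-bonacci word. -/
def mbFactor (m : ℕ) (w : List ℕ) : Prop := ∃ k, w <:+: mbIter m k

/-- The prefix of length n of the m-bonacci word. -/
def mbPrefix (m n : ℕ) : List ℕ := (mbIter m n).take n

/-- Abelian complexity: number of distinct Parikh vectors of factors of length n. -/
noncomputable def mbAC (m n : ℕ) : ℕ :=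
  Set.ncard ((fun (w : List ℕ) (ℓ : ℕ) => w.count ℓ) ''
    {w : List ℕ | mbFactor m w ∧ w.length = n})

/-- Tribonacci numbers. -/
def tribN : ℕ → ℕ
  | 0 => 0
  | 1 => 0
  | 2 => 1
  | n + 3 => tribN (n + 2) + tribN (n + 1) + tribN n

/-- Value of a digit string (most significant digit first) in the Tribonacci system. -/
def valT : List ℕ → ℕ
  | [] => 0
  | d :: rest => d * tribN (rest.length + 3) + valT rest

/-- L is the normal T-representation of n (MSB first, greedy). -/
def IsNormalTRep (n : ℕ) (L : List ℕ) : Prop :=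
  (∀ d ∈ L, d ≤ 1) ∧ (∀ d ∈ L.take 1, d = 1) ∧ valT L = n ∧
    ∀ S, S <:+ L → valT S < tribN (S.length + 3)

/-- Value of a digit string (MSB first) in the m-bonacci numeration system U_j = |σ_m^j(0)|. -/
def valU (m : ℕ) : List ℕ → ℕ
  | [] => 0
  | d :: rest => d * (mbIter m rest.length).length + valU m rest

/-- L is the normal U-representation of n (MSB first, greedy) in the m-bonacci system. -/
def IsNormalURep (m n : ℕ) (L : List ℕ) : Prop :=
  (∀ d ∈ L, d ≤ 1) ∧ (∀ d ∈ L.take 1, d = 1) ∧ valU m L = n ∧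
    ∀ S, S <:+ L → valU m S < (mbIter m S.length).length

/-- The set of relative Parikh vectors of factors of the Tribonacci word of length n. -/
def relParikhSetT (n : ℕ) : Set (Fin 3 → ℤ) :=
  {p | ∃ w, mbFactor 3 w ∧ w.length = n ∧
    ∀ ℓ : Fin 3, p ℓ = (w.count (ℓ : ℕ) : ℤ) - ((mbPrefix 3 n).count (ℓ : ℕ) : ℤ)}

/-- A comparison state for a position `i`, a length `n` and a position `j` close to `i + n`: the
letters at positions `i` and `j`, and the Parikh vector of the prefix of length `j` minus those of
the prefixes of lengths `i` and `n`. -/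
abbrev ComparisonState := ℕ × ℕ × ℤ × ℤ × ℤ

/-- The comparison states realised by the Tribonacci word, indexed by their position in the list. -/
def comparisonStates : List ComparisonState :=
  [(0, 0, 0, 0, 0), (0, 0, -1, 0, 0), (0, 0, 1, 0, 0), (0, 0, 1, 0, 1), (0, 0, 1, 1, 0),
    (0, 0, 2, 1, 0), (0, 1, 0, -1, 0), (0, 1, 1, 0, 0), (0, 1, 2, 0, 0), (0, 1, 2, 0, 1),
    (0, 1, 2, 1, 0), (0, 2, 0, 0, -1), (0, 2, 1, 0, 0), (0, 2, 2, 1, 0), (1, 0, -1, 0, 0),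
    (1, 0, 0, 1, 0), (1, 0, 1, 1, 0), (1, 0, 1, 1, 1), (1, 0, 1, 2, 0), (1, 1, 0, 0, 0),
    (1, 1, 1, 1, 0), (1, 1, 2, 1, 0), (1, 2, 1, 1, 0), (2, 0, -1, 0, 0), (2, 0, 0, 0, 1),
    (2, 0, 1, 1, 1), (2, 1, 1, 0, 1), (2, 2, 0, 0, 0), (0, 0, 0, 0, 1), (0, 0, 0, 1, 0),
    (0, 0, 1, 1, 1), (0, 0, 1, 2, 0), (0, 1, 0, 0, 0), (0, 1, 1, 0, 1), (0, 1, 1, 1, 0),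
    (0, 2, 0, 0, 0), (0, 2, 1, 1, 0), (1, 0, -1, 1, 0), (1, 0, 0, 1, 1), (1, 0, 0, 2, 0),
    (1, 1, -1, 0, 0), (1, 1, 0, 1, 0), (1, 1, 1, 1, 1), (1, 2, 0, 1, 0), (1, 2, 1, 2, 0),
    (2, 0, -1, 0, 1), (2, 0, 0, 1, 1), (2, 1, 0, 0, 1), (2, 1, 1, 1, 1), (2, 2, -1, 0, 0),
    (2, 2, 1, 1, 1), (0, 0, 0, -1, 0), (0, 0, 0, -1, 1), (0, 0, 2, 0, 1), (0, 1, 1, -1, 0),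
    (0, 1, 1, -1, 1), (0, 2, 0, -1, 0), (0, 2, 2, 0, 0), (0, 2, 2, 0, 1), (1, 0, 0, 0, 0),
    (1, 0, 0, 0, 1), (1, 1, 1, 0, 0), (1, 1, 1, 0, 1), (1, 2, 0, 0, 0), (1, 2, 2, 1, 0),
    (2, 0, -1, -1, 1), (2, 0, 1, 0, 1), (2, 0, 1, 0, 2), (2, 1, 0, -1, 1), (2, 1, 2, 0, 1),
    (2, 2, 1, 0, 1), (0, 0, -1, -1, 1), (0, 0, 1, 0, 2), (0, 1, 0, -1, 1), (0, 2, 1, 0, 1),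
    (1, 0, -1, 0, 1), (1, 1, 0, 0, 1), (1, 2, -1, 0, 0), (1, 2, 1, 1, 1), (2, 0, 0, 0, 2),
    (2, 1, -1, -1, 1), (2, 1, 1, 0, 2), (2, 2, 0, 0, 1), (0, 0, 0, 0, -1), (0, 0, 0, 1, -1),
    (0, 0, 1, 1, -1), (0, 1, 0, 0, -1), (0, 1, 1, 0, -1), (0, 2, 1, 0, -1), (0, 2, 1, 1, -1),
    (0, 2, 2, 1, -1), (1, 0, -1, 1, -1), (1, 0, 0, 1, -1), (1, 1, 0, 0, -1), (1, 2, 0, 1, -1),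
    (1, 2, 1, 1, -1), (2, 0, 0, 0, 0), (2, 0, 0, 1, 0), (2, 0, 1, 1, 0), (2, 1, 0, 0, 0),
    (2, 1, 1, 0, 0), (2, 2, 1, 1, 0), (2, 2, 2, 1, 0), (0, 0, -1, 1, -1), (0, 2, 0, 1, -1),
    (1, 2, -1, 1, -1), (2, 0, -1, 1, 0), (2, 1, -1, 0, 0), (2, 2, 0, 1, 0), (0, 0, 2, 0, 0),
    (0, 1, 3, 0, 0), (1, 0, 2, 1, 0), (1, 2, 0, 0, -1), (2, 1, 0, -1, 0), (2, 2, 1, 0, 0),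
    (0, 0, -1, 0, 1), (0, 0, -1, 1, 0), (0, 0, 0, 1, 1), (0, 1, -1, -1, 1), (0, 1, -1, 0, 0),
    (0, 1, 0, 0, 1), (0, 1, 1, 1, 1), (0, 2, -1, 0, 0), (0, 2, 0, 1, 0), (1, 0, -2, 0, 1),
    (1, 0, -2, 1, 0), (1, 0, -1, 1, 1), (1, 0, 0, 2, 1), (1, 1, -1, 0, 1), (1, 1, 0, 1, 1),
    (1, 2, -1, 1, 0), (2, 0, -2, 0, 1), (2, 0, -1, 1, 1), (2, 1, -1, 0, 1), (1, 1, -1, -1, 1),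
    (1, 1, 1, 2, 0), (0, 0, 1, -1, 1), (0, 1, 0, -2, 1), (0, 1, 2, -1, 1), (0, 2, 1, -1, 0),
    (1, 0, -1, -1, 1), (1, 0, 1, 0, 1), (1, 1, 0, -1, 0), (1, 1, 0, -1, 1), (1, 1, 2, 0, 1),
    (1, 2, 1, 0, 0), (2, 0, 0, -1, 1), (2, 1, 1, -1, 1), (2, 2, 0, -1, 0), (2, 2, 2, 0, 1),
    (0, 0, 2, 2, -1), (0, 1, 2, 1, -1), (1, 0, 1, 2, -1), (1, 1, 1, 1, -1), (1, 2, 2, 2, -1),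
    (2, 1, 2, 1, 0), (2, 2, 0, 0, -1), (0, 0, 1, 2, -1), (0, 1, 1, 1, -1), (0, 2, 2, 2, -1),
    (1, 0, 0, 2, -1), (1, 1, 0, 1, -1), (1, 2, 1, 2, -1), (2, 0, 1, 2, 0), (2, 1, 1, 1, 0),
    (0, 2, 1, 1, 1), (2, 0, 0, 1, 2), (2, 2, 0, 1, 1), (0, 0, 0, 0, 2), (0, 1, 1, 0, 2),
    (0, 2, 0, 0, 1), (1, 0, 0, 1, 2), (1, 2, 0, 1, 1), (2, 0, -1, 0, 2), (2, 1, 0, 0, 2),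
    (2, 2, -1, 0, 1), (0, 0, 1, -1, 0), (0, 1, 2, -1, 0), (0, 2, 3, 0, 0), (1, 0, 1, 0, 0),
    (1, 1, 2, 0, 0), (2, 0, 2, 0, 1), (0, 0, 0, 2, -1), (0, 1, 0, 1, -1), (0, 2, 1, 2, -1),
    (1, 0, -1, 2, -1), (1, 1, -1, 1, -1), (1, 2, 0, 2, -1), (2, 0, 0, 2, 0), (2, 1, 0, 1, 0),
    (2, 2, 1, 2, 0), (0, 0, 0, -1, 2), (0, 1, 1, -1, 2), (0, 2, 0, -1, 1), (1, 0, 0, 0, 2),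
    (1, 1, 1, 0, 2), (1, 2, 0, 0, 1), (2, 0, -1, -1, 2), (2, 1, 0, -1, 2), (2, 2, -1, -1, 1),
    (0, 0, -1, -1, 2), (0, 1, 0, -1, 2), (0, 2, -1, -1, 1), (1, 0, -1, 0, 2), (1, 1, 0, 0, 2),
    (1, 2, -1, 0, 1), (2, 0, -2, -1, 2), (2, 1, -1, -1, 2), (0, 0, 1, 0, -1), (0, 0, 2, 1, -1),
    (0, 1, 1, -1, -1), (0, 1, 2, 0, -1), (0, 2, 2, 0, -1), (0, 2, 3, 1, -1), (1, 0, 0, 0, -1),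
    (1, 0, 1, 1, -1), (1, 1, 1, 0, -1), (1, 2, 2, 1, -1), (2, 0, 1, 0, 0), (2, 0, 2, 1, 0),
    (2, 1, 2, 0, 0), (0, 2, 1, -1, -1), (1, 2, 1, 0, -1), (2, 0, 0, -1, 0), (2, 1, 1, -1, 0),
    (2, 2, 2, 0, 0), (0, 0, 0, 2, 0), (0, 1, 0, 1, 0), (0, 2, -1, 1, -1), (0, 2, 1, 2, 0),
    (1, 0, -1, 2, 0), (1, 1, -1, 1, 0), (1, 2, 0, 2, 0), (2, 0, -2, 1, 0), (2, 0, 0, 2, 1),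
    (2, 1, 0, 1, 1), (2, 2, -1, 1, 0), (0, 0, 1, -1, 2), (0, 1, 2, -1, 2), (0, 2, 1, -1, 1),
    (1, 0, 1, 0, 2), (1, 2, 1, 0, 1), (2, 0, 0, -1, 2), (2, 1, 1, -1, 2), (2, 2, 0, -1, 1),
    (0, 1, 3, 1, -1), (1, 0, 2, 2, -1), (1, 1, 2, 1, -1)]

/-- Indices of the successors of each comparison state under the digit 0. -/
def edgesZero : List (List ℕ) :=
  [[0, 7, 14, 19], [6], [4, 10, 15, 20], [5, 16, 21], [17], [], [11], [4, 13, 15, 22], [18], [],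
    [], [1], [4, 15], [], [6], [3, 9, 24, 26], [25], [], [], [0, 12, 23, 27], [25], [], [25], [6],
    [2, 8], [], [5], [0], [2, 8, 59, 61], [3, 9, 60, 62], [], [], [0, 12, 14, 63], [5, 16, 64],
    [17], [0, 14], [17], [52, 55, 65, 68], [53, 66, 69], [67], [56], [3, 58, 24, 70], [], [3, 24],
    [], [51, 54], [53], [2, 57], [], [], [], [86], [83, 87, 93], [], [84, 89, 91, 94],
    [85, 90, 92, 95], [], [18], [], [0, 7, 23, 99], [2, 8, 96, 100], [4, 13, 97, 101],
    [5, 98, 102], [0, 23], [], [], [5], [], [83, 88], [], [5], [], [111], [83, 88, 112], [5, 16],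
    [51, 54, 113], [2, 57, 96, 114], [], [], [109, 110], [], [], [2], [1, 32, 40],
    [28, 33, 75, 76], [30, 38, 42], [1, 35, 77], [29, 36, 37, 43], [29, 37], [30, 38], [],
    [71, 73, 80], [28, 33, 45, 47], [1, 35, 49], [28, 45], [30, 46], [0, 7], [3, 9], [], [0, 12],
    [4, 13], [], [], [71, 73, 134], [28, 75], [71], [52, 55], [56], [3], [18], [], [], [1], [11],
    [4], [51, 54, 142], [52, 55, 140, 143], [53, 141, 144], [], [56], [2, 57, 59, 145], [], [],
    [3, 60], [], [137], [136, 138, 146, 147], [], [51, 139, 148], [53, 66, 149], [52, 65], [],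
    [136, 138], [51, 139], [], [], [85, 151, 92, 153], [], [150, 152, 154], [84, 91], [],
    [5, 98, 155], [11], [83, 88, 156], [], [4, 97], [83, 87], [85, 90], [], [], [], [], [],
    [30, 46, 50], [], [], [1], [], [30, 38, 78], [], [72, 79, 81], [28, 74, 45, 82], [], [], [],
    [], [], [53], [109, 110, 179, 180], [111], [2, 59], [181], [53, 66], [176, 177], [109, 178],
    [51], [84, 158, 91, 161], [157, 159, 160, 162], [], [4, 10, 97, 164], [163], [],
    [72, 194, 195], [28, 74, 75, 196], [], [191, 192, 197, 198], [71, 193, 199], [72, 79], [],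
    [3, 58], [], [208, 211, 214, 216], [209, 213, 215, 217], [83], [109, 110, 218, 220], [219],
    [2, 96], [210], [208, 212], [], [210], [208, 212, 214, 222], [], [176, 177, 223, 224],
    [109, 178, 218, 225], [51], [], [221], [29, 34, 37, 41], [], [103, 104, 105], [31, 39, 44],
    [31, 39], [], [1, 32, 107], [30, 46, 48], [29, 36, 106, 108], [], [4, 10], [], [], [103],
    [29, 106], [86], [84, 89], [], [240], [3, 58, 60, 241], [71], [], [237, 238, 242, 243],
    [52, 239, 65, 244], [67], [137], [], [53], [52], [209, 245, 215, 247], [246], [85, 92], [219],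
    [5, 98], [208, 211], [209, 213], [83], [], [], []]

/-- Indices of the successors of each comparison state under the digit 1. -/
def edgesOne : List (List ℕ) :=
  [[1, 32, 40], [], [29, 34, 37, 41], [4, 10, 15, 20], [30, 38, 42], [], [], [29, 36, 37, 43],
    [31, 39, 44], [18], [], [], [29, 37], [], [], [28, 33, 45, 47], [30, 46, 48], [25], [],
    [1, 35, 49], [30, 46, 50], [], [30, 46], [], [0, 7], [], [4, 13], [1], [0, 7, 14, 19],
    [28, 33, 75, 76], [17], [], [1, 35, 77], [4, 13, 15, 22], [30, 38, 78], [1], [30, 38],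
    [71, 73, 80], [3, 9, 24, 26], [72, 79, 81], [], [28, 74, 45, 82], [25], [28, 45], [], [6],
    [3, 9], [0, 12], [], [], [], [], [86], [18], [103, 104, 105], [84, 89, 91, 94], [], [31, 39],
    [18], [1, 32, 107], [0, 7, 23, 99], [29, 36, 106, 108], [4, 13, 97, 101], [1], [], [],
    [4, 10], [5], [11], [], [4], [], [5, 16, 21], [11], [4, 15], [6], [0, 12, 23, 27], [], [25],
    [2, 8], [], [5], [0], [119], [115, 120, 124, 128], [117, 121, 126, 129], [122],
    [116, 123, 125, 130], [116, 125], [117, 126], [127], [118], [115, 120, 131, 133], [122],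
    [115, 131], [117, 132], [1, 32], [28, 33], [30], [1, 35], [29, 36], [30], [], [118],
    [115, 124], [], [71, 73], [], [28], [31, 39, 135], [], [], [], [], [29], [6], [71, 73, 134],
    [3, 9, 60, 62], [], [], [0, 12, 14, 63], [17], [], [28, 75], [], [], [52, 55, 65, 68], [67],
    [56], [3, 58, 24, 70], [71], [], [52, 55], [56], [], [], [84, 158, 91, 161], [],
    [157, 159, 160, 162], [103], [], [4, 10, 97, 164], [], [11], [163], [29, 106], [86], [84, 89],
    [], [], [], [127], [166], [117, 165, 132, 167], [], [], [], [171], [117, 165, 126, 172], [],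
    [168, 169, 173, 174], [115, 170, 131, 175], [166], [], [30], [17], [53], [3], [2, 8, 59, 61],
    [5, 16, 64], [0, 14], [53, 66, 69], [3, 24], [51, 54], [2, 57], [], [103, 183, 186],
    [182, 184, 185, 187], [], [29, 34, 106, 189], [31, 188, 190], [], [168, 169, 203, 204],
    [115, 170, 124, 205], [171], [200, 201, 206, 207], [202], [168, 173], [72], [28, 74], [],
    [83, 87, 93], [85, 90, 92, 95], [], [2, 8, 96, 100], [5, 98, 102], [0, 23], [], [83, 88], [],
    [], [83, 88, 112], [], [51, 54, 113], [2, 57, 96, 114], [], [], [], [116, 227, 125, 231],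
    [127], [228], [226, 229, 230, 232], [226, 230], [], [119], [117, 121, 132, 235],
    [116, 123, 233, 236], [234], [29, 34], [], [31], [], [116, 233], [], [103, 104], [31],
    [72, 194, 195], [28, 74, 75, 196], [], [], [191, 192, 197, 198], [71, 193, 199], [72, 79], [],
    [], [3, 58], [71], [85, 151, 92, 153], [150, 152, 154], [84, 91], [5, 98, 155], [4, 97],
    [83, 87], [85, 90], [], [], [], [234]]

/-- The relative Parikh vectors of factors of the Tribonacci word. -/
def balancedVectors : List (ℤ × ℤ × ℤ) :=
  [(-1, -1, 2), (-1, 0, 1), (-1, 1, 0), (-1, 2, -1), (0, -1, 1), (0, 0, 0), (0, 1, -1),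
    (1, -1, 0), (1, 0, -1)]

/-- For each comparison state, the index of its relative Parikh vector if the lengths agree. -/
def balancedIndices : List (List ℕ) :=
  [[5], [], [], [], [], [], [], [], [], [], [], [], [], [], [], [], [], [], [], [5], [], [], [],
    [], [], [], [], [5], [], [], [], [], [5], [], [], [5], [], [2], [], [], [], [], [], [], [],
    [1], [], [], [], [], [], [], [4], [], [7], [], [], [], [], [5], [], [], [], [5], [], [], [],
    [], [4], [], [], [], [], [4], [], [1], [], [], [], [], [], [], [], [], [6], [], [], [8], [8],
    [], [], [], [6], [], [6], [], [5], [], [], [5], [], [], [], [], [6], [], [2], [], [], [], [],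
    [], [], [], [], [1], [2], [], [], [], [], [], [], [], [], [], [], [], [1], [], [2], [], [],
    [1], [], [], [], [], [], [7], [], [], [], [4], [], [], [4], [], [], [], [], [], [], [], [],
    [], [], [], [], [], [], [6], [], [], [], [], [], [], [], [], [], [], [], [], [], [1], [7], [],
    [], [], [], [], [], [6], [], [3], [], [], [], [], [], [], [], [4], [], [], [], [0], [], [],
    [0], [], [], [], [], [1], [], [0], [8], [], [], [], [], [], [], [], [8], [], [], [], [], [],
    [8], [], [7], [], [], [], [], [], [], [2], [], [], [], [], [2], [], [], [], [], [], [], [],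
    [4], [], [], []]

/-- The subset automaton: the bit mask of the comparison states, the successors under the digits
0 and 1, the current letter, and the class in the reduced automaton. -/
def subsetRows : List (ℕ × ℕ × ℕ × ℕ × ℕ) :=
  [(268435455, 0, 1, 0, 0),
    (2251799580157075, 2, 3, 1, 1),
    (2361180989635131339773, 4, 5, 0, 2),
    (9669045375062613020046043, 6, 0, 2, 3),
    (10141195130419278294940496429053, 7, 8, 0, 4),
    (642246483945419070364586553420979, 9, 10, 1, 5),
    (40889417308281730944463306295606269, 11, 12, 0, 6),
    (1485184259686568057372671, 13, 14, 0, 7),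
    (21778029944565193383034948883462111929491, 15, 16, 1, 8),
    (21778071482940063149201414763275258426367, 17, 18, 0, 9),
    (3176065680803461311485937301241002128091, 19, 0, 2, 10),
    (10141195130419278296182278848511, 20, 21, 0, 11),
    (43599426594739353591842450333253263207571, 22, 23, 1, 5),
    (36346157557063756769499122008850431, 11, 24, 0, 6),
    (1485184261114303231229659, 25, 26, 1, 12),
    (1427160580420028120811641706730982238851953661, 27, 28, 0, 13),
    (21778071482940071332376945704806770209499, 29, 0, 2, 14),
    (36356219204874898263231489225261053, 30, 31, 0, 15),
    (642246483945419070364586776395515, 32, 33, 1, 5),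
    (700818340361900601580371002442338573153467389, 34, 35, 0, 16),
    (1485531401649445402574847, 36, 37, 0, 17),
    (21778029944565194868219207745965531636883, 38, 39, 1, 18),
    (12740171817519936073556290742133043929805823, 40, 18, 0, 9),
    (24954137163743522973141912176874167661275, 19, 0, 2, 10),
    (43283628859230268530501707886838983827, 22, 23, 1, 5),
    (36346157557065085223302805246966783, 11, 41, 0, 6),
    (9669045375625563117387483, 42, 0, 2, 3),
    (181260456973656915035597448539364177261105250301, 43, 44, 0, 4),
    (46585364689922531159988937988250591616119403228339, 45, 46, 1, 19),
    (40896128374662828129274202401012733, 47, 48, 0, 20),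
    (3350582915575710570916513579007, 49, 50, 0, 21),
    (21778030583461095898062567237800527438995, 51, 52, 1, 22),
    (21778071482940063149201414763275403131903, 53, 18, 0, 9),
    (3176065680803461311485937864190956861147, 19, 0, 2, 10),
    (89916604640475482647867146494596489774391885823, 54, 55, 0, 11),
    (46585364733521957112481807634673971584786113014931, 56, 57, 1, 19),
    (36352868623444853954310018114256895, 47, 58, 0, 20),
    (3350582915575711998651687435995, 59, 60, 1, 23),
    (1427160580456374278368704430773295408822875133, 61, 62, 0, 16),
    (21778071482940071332376945704806912817883, 63, 0, 2, 14),
    (91343852333217788606935176943030920217721044989, 30, 31, 0, 15),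
    (43283628859230268530500581986932141235, 22, 23, 1, 5),
    (40889417308281730944463306295606271, 11, 12, 0, 6),
    (1485184260812467964215295, 13, 14, 0, 7),
    (327376366783900283622190595911482345286391001556115, 15, 64, 1, 8),
    (21778071482940071333062529576370413761535, 65, 66, 0, 9),
    (95547131042148285246164903084971204630327486931727067, 67, 0, 2, 24),
    (10141195130419279119004865658879, 68, 69, 0, 25),
    (64972291230839357305367905275354092448915, 70, 71, 1, 26),
    (36346157558548941028397128970403839, 72, 73, 0, 27),
    (3176065680803453127624823352931213311707, 74, 75, 1, 18),
    (1427182358491511060873352947553928003560666109, 76, 77, 0, 28),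
    (21799712976246444493932660813506959569627, 78, 0, 2, 14),
    (36356219204874898263231489225261055, 30, 31, 0, 15),
    (1485531402775345309417471, 36, 37, 0, 17),
    (327376366783900283622190597396666604148894421263507, 38, 79, 1, 18),
    (12740171817519936081740151856946139085140991, 80, 66, 0, 9),
    (95547131042170063317647843146632860605203120097260251, 67, 0, 2, 24),
    (21416148264959233982055956649987668225171, 70, 71, 1, 26),
    (36346157558550269482200812208520191, 72, 81, 0, 27),
    (3176065680803461311485937864191099469531, 82, 0, 2, 10),
    (181260456973656915035597448539364178502887669759, 54, 55, 0, 11),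
    (46585364689965814146601684311362021833519781948595, 56, 57, 1, 19),
    (40896128374662828129274202401012735, 47, 48, 0, 20),
    (21778071482940071332376954712006024950491, 29, 0, 2, 14),
    (40899478956092872438195673513328637, 30, 83, 0, 15),
    (642246483945419070364586778558463, 84, 85, 1, 5),
    (6034201192860255720147892020984713412941123866751400957, 86, 87, 0, 29),
    (1486216986872519826866175, 88, 89, 0, 30),
    (21778029944565194868219207745965620393691, 90, 91, 1, 18),
    (1070370435315021090610217054602382094883353599, 92, 93, 0, 28),
    (24954137163743522974817507943434752291547, 94, 0, 2, 31),
    (36356219204874898263232731007680511, 95, 96, 0, 32),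
    (43283628859230268530501707887061958363, 97, 98, 1, 5),
    (700818340357357341829154356721178072104827903, 34, 62, 0, 16),
    (9669392517588440462589659, 63, 0, 2, 14),
    (181260456973672491926173053025152338709933195261, 99, 100, 0, 15),
    (46585364689922531159988937988250591616119403769075, 101, 102, 1, 19),
    (5575186340528784160046757697436292777507837, 47, 48, 0, 20),
    (21778071482940071332376954712006167558875, 63, 0, 2, 14),
    (91343852333222331866686394917205884402009112573, 30, 83, 0, 15),
    (43283628859230268530500581987155115771, 97, 98, 1, 5),
    (700818340361900601580371002442338573153467391, 34, 35, 0, 16),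
    (65334173549341219221374516989066858505363, 51, 52, 1, 22),
    (21778071482940063149201414763275404443647, 53, 103, 0, 9),
    (3176065680803461311485938166026226038491, 104, 0, 2, 10),
    (46675281294563006000390321189326117741307241693183, 105, 106, 0, 33),
    (3132420932115241560006418435977039605990674350529395862675, 107, 108, 1, 34),
    (36356219204875245405194366570463231, 109, 110, 0, 35),
    (642246485430603330352990102945499, 111, 60, 1, 23),
    (1427160580456374278368704430773295408967580669, 61, 62, 0, 16),
    (21778071482940071332376946267756867550939, 63, 0, 2, 14),
    (181260456973693261113607193018349113809834082301, 99, 100, 0, 15),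
    (46585364689922531159988937988250591616119626202875, 112, 113, 1, 19),
    (700818340361907312646752099627149469258873853, 114, 115, 0, 36),
    (3350582915922852533793858781183, 116, 117, 0, 37),
    (21778030583461097383246826100303947146387, 118, 119, 1, 38),
    (12740171817519936073556290742133044074511359, 120, 18, 0, 9),
    (24954137163743522973141912739824122394331, 19, 0, 2, 10),
    (3350582915575711696816420421631, 49, 50, 0, 21),
    (327376366783900284261086498426509963640729417065619, 51, 121, 1, 22),
    (21778071482940071333062529576370556369919, 122, 66, 0, 9),
    (95547131042148285246164903084971204630890436885148379, 67, 0, 2, 24),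
    (642246483945419071490486683238139, 32, 33, 1, 5),
    (700818340361900601580372330896142256392895485, 34, 123, 0, 16),
    (9669392517588440464752639, 124, 125, 0, 17),
    (95734203251745242783958736477115622127288170826736787, 126, 127, 1, 39),
    (1603799493391296947900216015149494851054303673006699903185919, 128, 129, 0, 40),
    (409769201381589651305370396864644306789794624019815293099111131, 130, 0, 2, 41),
    (10141196615603537981508285366271, 131, 132, 0, 42),
    (21778030586811677328454018122148992035987, 133, 71, 1, 26),
    (21778107829097620211925457076445374053375, 72, 81, 0, 27),
    (21778071482940071333062529576370558467071, 122, 66, 0, 9),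
    (95547131042148285246164903084971204630890436886460123, 67, 0, 2, 24),
    (89916604640475482647867146494597312596978696191, 134, 135, 0, 25),
    (46585364754894821748581811348199426526886942256275, 136, 137, 1, 43),
    (36352868624930038213208025075810303, 138, 139, 0, 44),
    (3176065684154034558016274237279669518043, 140, 141, 1, 45),
    (1427182358527857218430415671596241173531587581, 142, 143, 0, 46),
    (21799712976246444493932660813507102178011, 144, 0, 2, 14),
    (91343852333217788606935176943030920217721044991, 30, 31, 0, 15),
    (21799712976246444493932669820706214310619, 78, 0, 2, 14),
    (40899478956092872438195673513328639, 30, 83, 0, 15),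
    (46585364733521957112481807634673971584786113014963, 56, 57, 1, 19),
    (40896128374662828129274202402324479, 47, 145, 0, 20),
    (3350582915575711998651689598975, 146, 147, 1, 23),
    (6034201193586597960246908957524264815447044886708876285, 148, 149, 0, 29),
    (21778071482940071333062530927881337175039, 150, 0, 2, 47),
    (3369581957254499672914181995915036828445083763768369049574123241469, 151, 152, 0, 48),
    (649037097645446897775178550345727, 153, 154, 1, 49),
    (104926009473732067780715008923785242179871382869504569505256642968573, 155, 156, 0, 50),
    (36346157558548941029185689797787647, 157, 158, 0, 51),
    (21778029944565194868219207745965763002075, 159, 91, 1, 18),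
    (1427182358491511060874788546964755878979040255, 92, 93, 0, 28),
    (1486216987998419733708799, 88, 89, 0, 30),
    (327376366783900283622190597396666604148894510020315, 90, 160, 1, 18),
    (1070370435315021090618400915717195190038688767, 161, 162, 0, 28),
    (95547131042170063317647843146634536200969680681890523, 163, 0, 2, 52),
    (36356219204874898264055553594490879, 164, 165, 0, 53),
    (21416148264959233982055956649987891199707, 166, 167, 1, 26),
    (700818340357357341830639540980076079066381311, 168, 169, 0, 46),
    (3176065680803461311833079827068444671707, 170, 0, 2, 31),
    (181260456973672491926173053025152339951715614719, 171, 172, 0, 32),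
    (46585364689965814146601684311362021833519782489331, 173, 174, 1, 19),
    (5575186340528784160046757697436292777507839, 47, 48, 0, 20),
    (64972291230839357305367906401253999291539, 70, 71, 1, 26),
    (36346157558550269482200812209831935, 72, 175, 0, 27),
    (3176065680803461311485938166026368646875, 176, 0, 2, 10),
    (46766625146896187432778051491370885430035737477119, 105, 106, 0, 33),
    (3132420932115241560006418435977039605990674350529395862707, 107, 108, 1, 34),
    (40899478956093219580158550858530815, 109, 177, 0, 35),
    (642246485430603329227090198265855, 178, 179, 0, 21),
    (220748043310629438638733519532582070129290279750983581992265427579085971, 180, 181, 1, 54),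
    (21778071482940063149201415551836231827455, 88, 182, 0, 30),
    (21778029944565203052080322559060775728859, 183, 0, 2, 10),
    (46675281294563006314767670045927009315257743048703, 184, 185, 0, 33),
    (19734680960357400750628370285258376071538366756905689730518372098288787, 186, 187, 1, 55),
    (36356219204875245405195608352882687, 188, 189, 0, 56),
    (43283628859231753714760570390481665755, 190, 191, 1, 23),
    (1427160580456374278368704430773295408967580671, 61, 62, 0, 16),
    (21778071482940071332376955274956122291931, 63, 0, 2, 14),
    (181260456973697804373358410992524077994122149885, 99, 192, 0, 15),
    (46585364689922531159988937988250591616119628365823, 193, 194, 1, 19),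
    (6034201192860255720147898732051094510125934762856807421, 195, 196, 0, 57),
    (3350582916608437756868283072511, 197, 198, 0, 58),
    (21778030583461097383246826100304035903195, 199, 200, 1, 38),
    (1070370435315021090610217054602382095028059135, 201, 93, 0, 28),
    (24954137163743522974817508506384707024603, 94, 0, 2, 31),
    (89916604640511828725876890973581426323120717823, 171, 172, 0, 32),
    (46585364689965814146601684311362021833520004923131, 202, 203, 1, 19),
    (700818340361907312646752099627149469258873855, 114, 115, 0, 36),
    (3350582915922853659693765623807, 116, 117, 0, 37),
    (327376366783900284261086499911694222503232836773011, 118, 204, 1, 38),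
    (12740171817519936081740151856946139227749375, 205, 66, 0, 9),
    (95547131042170063317647843146632860605766070050681563, 67, 0, 2, 24),
    (43283628859230268530501707887061958395, 97, 98, 1, 5),
    (700818340361900601580372330896142256392895487, 34, 123, 0, 16),
    (65334173552691800651765967873415323102355, 133, 71, 1, 26),
    (21778107829097620211925457076445375365119, 72, 175, 0, 27),
    (3176065680803461311485938166026368646875, 176, 206, 1, 18),
    (56318250189811000505467607837607710050492560273783707237680125669762921469, 207, 208, 0, 59),
    (1603799493391296935181843910605805213808084476874067777614555, 209, 0, 2, 60),
    (642246485430603330352990102945531, 111, 60, 1, 23),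
    (1427160580460917538119922404948259593255648253, 61, 123, 0, 16),
    (21778071482940071332376946267756869713919, 124, 125, 0, 17),
    (95734203251745242783958736485299483242101265982071955, 126, 210, 1, 39),
    (56318250189812604304960999133128427908016198707761408593799204366105441279, 211, 212, 0, 40),
    (411373000874980948240530441062273865559108775835875853917156059, 213, 0, 2, 61),
    (10141196615950679944385630568447, 214, 215, 0, 62),
    (21778030586811678813638276984652411743379, 216, 217, 1, 45),
    (12740171853866093630619014784446214045432831, 218, 81, 0, 27),
    (24954137163743522973141912739824265002715, 82, 0, 2, 10),
    (327376366827456427226966621749821913391995748131987, 51, 121, 1, 22),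
    (21778071482940071333062529576370559778815, 122, 219, 0, 9),
    (95547131042148285246164903084971204631192272155637467, 220, 0, 2, 24),
    (46675281294563006000390321189326118564129828503551, 221, 222, 0, 63),
    (3132420932115241581379283072077043319516129292630225104019, 223, 224, 1, 64),
    (36356219206360429664092373532016639, 225, 226, 0, 65),
    (3176066323049937073043892591618085027547, 227, 141, 1, 45),
    (1427182358527857218430415671596241173676293117, 142, 143, 0, 46),
    (21799712976246444493932661376457056911067, 144, 0, 2, 14),
    (181260456973693261113607193018349113809834082303, 99, 100, 0, 15),
    (12740171817519936081740151856946139229846527, 205, 66, 0, 9),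
    (95547131042170063317647843146632860605766070051993307, 67, 0, 2, 24),
    (21799712976246444493932669820706356919003, 144, 0, 2, 14),
    (91343852333222331866686394917205884402009112575, 30, 83, 0, 15),
    (9669392517588440464752639, 124, 0, 2, 14),
    (395773743423201743000597692233143358542719077465484421104620556992120881149, 228, 229, 0, 48),
    (46675281294563006632818915454117089319161538866419, 230, 231, 1, 66),
    (3369581957254499672822843718768155025362557415608860601464891636733, 232, 233, 0, 67),
    (21778071482940071333062530927881339272191, 150, 0, 2, 47),
    (395773745879940047081158313080595743460393221345222410387608838663670071293, 151, 152, 0, 48),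
    (89916604640476121543769661522215968770663383039, 234, 235, 1, 49),
    (107839375292469263078350381861503031248943316719608822653315355245565, 236, 237, 0, 68),
    (36352868624930038213996585903194111, 238, 239, 0, 69),
    (21778029947915776298610658630314219208411, 240, 241, 1, 45),
    (1427182358527857218431851271007069048949961727, 242, 169, 0, 46),
    (24954137163743522974817507943434894899931, 170, 0, 2, 31),
    (91343852333217788606935176943030921459503464447, 95, 96, 0, 32),
    (642246483945419071490486685401087, 84, 85, 1, 5),
    (6034201192860255720147892020984714741394927549990829053, 86, 149, 0, 29),
    (9670078102811514889043967, 150, 243, 0, 30),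
    (95734203251745242783958736477115622127288170915493595, 244, 245, 1, 39),
    (1603799493391298005530479512650649387715067533255750856733695, 246, 247, 0, 70),
    (409769201381589651305370396864644306789796299615581853683741403, 248, 0, 2, 71),
    (36356219206360082522918057014198271, 249, 250, 0, 72),
    (21778030586811677328454018122149215010523, 251, 167, 1, 26),
    (700840118428840281892301196954951712231914495, 168, 169, 0, 46),
    (3350582915575711998651689598975, 146, 179, 0, 21),
    (96085249921724880228520618136921864005103869220361110286293996345271443, 180, 252, 1, 54),
    (21778071482940071333062530927881337175039, 150, 253, 0, 30),
    (95734203251745242783958736485299483241799430800339675, 254, 0, 2, 24),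
    (649037097645446897775178550345727, 153, 255, 0, 25),
    (220748043310629438638733519532581708246971777889067575380551714813029523, 256, 257, 1, 73),
    (21778071482940063149201416677736138670079, 88, 182, 0, 30),
    (327376366783900283622190605580527718961989665355483, 183, 0, 2, 10),
    (46675281294563006639286223704353736467919463776255, 258, 259, 0, 33),
    (220748043310632571059665634774082370491664568378288556981695999630421139, 260, 261, 1, 64),
    (36356219204875245406018430939693055, 262, 263, 0, 69),
    (21416148264959235467240215512491310907099, 264, 241, 1, 45),
    (1427160580456374278370189615032193415929134079, 242, 169, 0, 46),
    (24954137163743522974817508506384849632987, 170, 0, 2, 31),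
    (181260456973693261113607193018349115051616501759, 171, 172, 0, 32),
    (642246485430603330352990105108479, 178, 147, 1, 23),
    (6034201193586597960246908957524264815447044886853581821, 148, 149, 0, 29),
    (21778071482940071333062531490831291908095, 150, 0, 2, 47),
    (3369581957254499673004098600555512300951755779843687243166236278781, 265, 266, 0, 48),
    (46585364689922531166779551688278419026711400153087, 267, 268, 1, 66),
    (104926009473732067780715008923785242186582449250601754316152748375037, 269, 270, 0, 57),
    (36349508139979332480070038253993983, 271, 272, 0, 69),
    (21778030583461097383246826100304178511579, 273, 200, 1, 38),
    (1427182358491511060874788546964755879123745791, 201, 93, 0, 28),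
    (1603799493391296935181843910605805213808084485881267032355547, 209, 0, 2, 60),
    (642246485430603329227090198265855, 178, 147, 1, 23),
    (6034201193586597960246908957524263486993241203614153725, 148, 87, 0, 29),
    (21778029944565203052080322559060775728859, 183, 274, 1, 18),
    (56318250189811000505467607837250898127316070303520571344728579761085608959, 275, 276, 0, 59),
    (1603799493391296935184998334793302292288969324003995570336475, 277, 0, 2, 74),
    (21778071482940071332376955274956124454911, 124, 125, 0, 17),
    (95734203251745242783958736485299483242101265982203547, 278, 279, 1, 39),
    (56318250189812604304960999133153951807794204460028869396353446436110332927, 280, 281, 0, 70),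
    (411373000874980948240530441062273865559108929503198739425850075, 282, 0, 2, 71),
    (10141196616636265167460054859775, 283, 284, 0, 69),
    (21778030586811678813638276984652500500187, 285, 241, 1, 45),
    (1070370435351367248167279778644695264998980607, 242, 169, 0, 46),
    (642246485430603330352990105108479, 178, 179, 0, 21),
    (220748043310629438639060895899344192382967905153512029388668356468712595, 180, 252, 1, 54),
    (21778071482940071333062530364931387162623, 150, 243, 0, 30),
    (95547131042166887210428664826711799015585306705327835, 244, 0, 2, 24),
    (46675281294563006314767670045927010138080329859071, 286, 287, 0, 63),
    (19734680960357400750628370285279748936174466760619215185460472927530131, 288, 289, 1, 64),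
    (36356219206360429664093615314436095, 283, 284, 0, 69),
    (3219349309662683396155322809018463747803, 290, 291, 1, 45),
    (1427182358527857218430415671596241173676293119, 142, 143, 0, 46),
    (21778071482940071332376946267756869713919, 124, 0, 2, 14),
    (395773743423201743000597692233143358542739846652918561097817332092021768189, 228, 229, 0, 48),
    (46675281294563006632818915454117089319161761300219, 292, 293, 1, 66),
    (3369581957254499672823538961922176403891044120950790314641373002749, 294, 295, 0, 75),
    (6034201193586597960246908957524264815447044886710973437, 148, 149, 0, 29),
    (21778071482940071333062530927881340583935, 150, 0, 2, 47),
    (395773745879940047081158313170512348100868693851894426462927032255783108605, 265, 266, 0, 48),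
    (46675281294563006639286223704353737220303513190399, 286, 296, 1, 66),
    (107839375292469263078350381861503031255654383100706007464211460652029, 297, 298, 0, 57),
    (36356219206360429664880934359400447, 283, 284, 0, 69),
    (21778030586811678813638276984652634717915, 285, 241, 1, 45),
    (1427182358527857218431851271007069049094667263, 242, 169, 0, 46),
    (21778071482940071333062531490831294005247, 150, 243, 0, 30),
    (95734203251745242783958736485299483242101266070828763, 244, 299, 1, 39),
    (56318250189812604304960999134186058171513699862298069357659453417058989055, 280, 281, 0, 70),
    (411373000874980948240530441062273865559110451431642414501786331, 282, 0, 2, 71),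
    (713558512174877277902708286282321480903293951, 242, 169, 0, 46),
    (24954137163743522973489054702701610204891, 170, 0, 2, 31),
    (21778071482940071333062530927881339272191, 150, 253, 0, 30),
    (95734203251745242783958736485299483241799430801651419, 254, 0, 2, 24),
    (89916604640476121543769661522215968770663383039, 234, 300, 0, 25),
    (220748043310629438638780104897271630777489520343110406901803247662836883, 301, 302, 1, 76),
    (95734203251745242783958736485299483242101266070828763, 244, 0, 2, 24),
    (46675281294563006639286223704353737220303513190399, 286, 287, 0, 63),
    (220748043310632571059665634774098115238813015575081723604568990945684627, 288, 289, 1, 64),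
    (21778071482940071333062531490831294005247, 150, 0, 2, 47),
    (327376366783900283622190605580527718961989665355483, 183, 303, 1, 18),
    (56318250189811000505467607837250898127316070303528755205843392856240944127, 304, 305, 0, 59),
    (1603799588938427977330107515277401915948688017030241499935451, 306, 0, 2, 71),
    (21778071482940071332376955274956124454911, 124, 0, 2, 14),
    (395773743423201743000597692233143358542744389912669779071992296276309835773, 228, 307, 0, 48),
    (46675281294563006632818915454117089319161763463167, 308, 296, 1, 66),
    (3369581957260533874015698399301962395310448463361289099934970936317, 297, 298, 0, 57),
    (96085249921724880228520618136965420148069749343684422236045262676337811, 180, 252, 1, 54),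
    (21778071482940071333062530927881340583935, 150, 243, 0, 30)]

/-- The reduced automaton: the successors under the digits 0 and 1, and the bit mask of the output. -/
def reducedRows : List (ℕ × ℕ × ℕ) :=
  [(0, 1, 32), (2, 3, 38), (4, 5, 176), (6, 0, 54), (7, 8, 352), (9, 10, 102), (11, 5, 432),
    (6, 12, 54), (13, 14, 38), (15, 5, 178), (16, 0, 54), (17, 18, 356), (6, 3, 54), (4, 19, 176),
    (20, 0, 54), (21, 22, 480), (11, 19, 432), (20, 23, 54), (16, 14, 54), (9, 24, 102),
    (25, 26, 496), (27, 18, 118), (28, 14, 102), (27, 10, 118), (29, 0, 54), (30, 18, 358),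
    (28, 31, 102), (32, 5, 434), (15, 19, 178), (33, 34, 432), (35, 23, 182), (36, 0, 54),
    (37, 38, 484), (17, 39, 356), (40, 41, 110), (42, 26, 496), (25, 43, 496), (44, 45, 118),
    (46, 14, 118), (29, 47, 54), (48, 49, 179), (50, 0, 55), (51, 18, 374), (28, 52, 102),
    (53, 26, 498), (46, 31, 118), (32, 19, 434), (35, 0, 182), (21, 54, 480), (30, 10, 358),
    (33, 55, 432), (56, 23, 438), (57, 0, 54), (58, 38, 486), (59, 60, 102), (40, 61, 110),
    (62, 45, 500), (63, 64, 496), (65, 45, 246), (48, 66, 178), (67, 0, 55), (68, 0, 55),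
    (69, 45, 374), (30, 39, 358), (70, 71, 110), (72, 26, 498), (30, 24, 358), (25, 73, 496),
    (33, 64, 432), (69, 45, 502), (48, 66, 179), (57, 0, 55), (69, 38, 502), (59, 74, 102),
    (75, 0, 55), (25, 76, 496), (59, 71, 102)]

/-- The letters of the image of a letter under the Tribonacci substitution, with their offsets. -/
def imageLetters (x : ℕ) : List (ℕ × ℕ) :=
  if x < 2 then [(0, 0), (x + 1, 1)] else [(0, 0)]

/-- The successors of a comparison state when the digit `d` is appended to the length. -/
def comparisonSucc (d : ℤ) (s : ComparisonState) : List ComparisonState :=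
  (imageLetters s.1).flatMap fun p => (imageLetters s.2.1).flatMap fun r =>
    let a := s.2.2.1 + s.2.2.2.1 + s.2.2.2.2 + r.2 - p.2 - d
    let b := s.2.2.1
    let c := s.2.2.2.1
    if -1 ≤ a + b + c ∧ a + b + c ≤ 3 then [(p.1, r.1, a, b, c)] else []

/-- The Parikh vector of a comparison state comparing equal lengths. -/
def balancedVector (s : ComparisonState) : List (ℤ × ℤ × ℤ) :=
  if s.2.2.1 + s.2.2.2.1 + s.2.2.2.2 = 0 then [s.2.2] else []

/-- Set the bits of `m` at the positions in the list. -/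
def setBits : List ℕ → ℕ → ℕ
  | [], m => m
  | j :: l, m => setBits l (Nat.lor m (Nat.shiftLeft 1 j))

/-- The image of a bit mask under a relation given by its lists of successors. -/
def imageMask : List (List ℕ) → ℕ → ℕ
  | [], _ => 0
  | l :: F, m =>
    bif Nat.beq (Nat.mod m 2) 1 then setBits l (imageMask F (Nat.div m 2))
    else imageMask F (Nat.div m 2)

/-- The set of entries of a list selected by a bit mask. -/
def decodeMask {α : Type*} (V : List α) (m : ℕ) : Set α :=
  {v | ∃ i, V[i]? = some v ∧ m.testBit i}

/-- The row of a state of the subset automaton. -/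
def subsetRow (q : ℕ) : ℕ × ℕ × ℕ × ℕ × ℕ := subsetRows.getD q (0, 0, 0, 0, 0)

/-- The bit mask of a state of the subset automaton. -/
def subsetMask (q : ℕ) : ℕ := (subsetRow q).1

/-- The current letter at a state of the subset automaton. -/
def subsetLetter (q : ℕ) : ℕ := (subsetRow q).2.2.2.1

/-- The transition function of the subset automaton. -/
def subsetNext (q d : ℕ) : ℕ :=
  if d = 0 then (subsetRow q).2.1 else (subsetRow q).2.2.1

/-- The class in the reduced automaton of a state of the subset automaton. -/
def subsetClass (q : ℕ) : ℕ := (subsetRow q).2.2.2.2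

/-- The row of a state of the reduced automaton. -/
def reducedRow (c : ℕ) : ℕ × ℕ × ℕ := reducedRows.getD c (0, 0, 0)

/-- The transition function of the reduced automaton. -/
def reducedNext (c d : ℕ) : ℕ :=
  if d = 0 then (reducedRow c).1 else (reducedRow c).2.1

/-- The lists of successors of the comparison states under a digit. -/
def comparisonEdges (d : ℕ) : List (List ℕ) := if d = 0 then edgesZero else edgesOne

/-- The transition of the subset automaton under the digit `d` is compatible with the comparison
states, the current letters and the reduced automaton. -/
def subsetStepCheck (q d : ℕ) : Bool :=
  let q' := subsetNext q d
  Nat.blt q' 309 && Nat.beq (subsetMask q') (imageMask (comparisonEdges d) (subsetMask q)) &&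
    Nat.beq (subsetLetter q') (if d = 0 then 0 else subsetLetter q + 1) &&
    Nat.beq (subsetClass q') (reducedNext (subsetClass q) d)

theorem subsetStepCheck_all : (List.range 309).all (fun q =>
    subsetStepCheck q 0 && (Nat.ble 2 (subsetLetter q) || subsetStepCheck q 1) &&
      Nat.blt (subsetClass q) 77 &&
      Nat.beq (reducedRow (subsetClass q)).2.2 (imageMask balancedIndices (subsetMask q))) := by
  decide +kernel

theorem reducedNext_all : (List.range 77).all (fun c =>
    Nat.blt (reducedNext c 0) 77 && Nat.blt (reducedNext c 1) 77) := by
  decide +kernel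

/-- The index lists `F` represent the lists of successors `φ` from entries of `U` to entries of
`V`. -/
def Represents {α β : Type*} (F : List (List ℕ)) (U : List α) (V : List β) (φ : α → List β) :
    Prop :=
  F.map (fun l => l.map (V[·]?)) = U.map (fun s => (φ s).map some)

instance {α β : Type*} [DecidableEq β] (F : List (List ℕ)) (U : List α) (V : List β)
    (φ : α → List β) : Decidable (Represents F U V φ) :=
  inferInstanceAs (Decidable (_ = _))

theorem represents_edgesZero :
    Represents edgesZero comparisonStates comparisonStates (comparisonSucc 0) := by
  decide +kernel

theorem represents_edgesOne :
    Represents edgesOne comparisonStates comparisonStates (comparisonSucc 1) := by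
  decide +kernel

theorem represents_balancedIndices :
    Represents balancedIndices comparisonStates balancedVectors balancedVector := by
  decide +kernel

/-- The bounds ensuring that positions far apart stay far apart after substitution. -/
theorem comparisonStates_expanding : ∀ s ∈ comparisonStates,
    (s.2.2.1 + s.2.2.2.1 + s.2.2.2.2 = 3 → ∀ p ∈ imageLetters s.1,
      3 < 2 * s.2.2.1 + 2 * s.2.2.2.1 + s.2.2.2.2 + (imageLetters s.2.1).length - p.2 - 1) ∧
    (s.2.2.1 + s.2.2.2.1 + s.2.2.2.2 = -1 → 2 * s.2.2.1 + 2 * s.2.2.2.1 + s.2.2.2.2 - 1 < -1) := by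
  decide +kernel

theorem initialMask_eq :
    (fun m => m ||| imageMask (comparisonEdges 0) m)^[28] 1 = subsetMask 0 := by
  decide +kernel

theorem imageMask_initial :
    imageMask (comparisonEdges 0) (subsetMask 0) = subsetMask 0 := by
  decide +kernel

section Word

theorem mbApply_append (m : ℕ) (u v : List ℕ) :
    mbApply m (u ++ v) = mbApply m u ++ mbApply m v := by
  simp [mbApply]

theorem mbIter_succ (m k : ℕ) : mbIter m (k + 1) = mbApply m (mbIter m k) := by
  simp [mbIter, Function.iterate_succ_apply']

theorem mbApply_prefix {m : ℕ} {u v : List ℕ} (h : u <+: v) : mbApply m u <+: mbApply m v := by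
  obtain ⟨w, rfl⟩ := h
  exact ⟨mbApply m w, (mbApply_append m u w).symm⟩

theorem mbIter_prefix_succ (k : ℕ) : mbIter 3 k <+: mbIter 3 (k + 1) := by
  induction k with
  | zero => exact ⟨[1], rfl⟩
  | succ k ih =>
    rw [mbIter_succ, mbIter_succ 3 (k + 1)]
    exact mbApply_prefix ih

theorem mbIter_prefix {k l : ℕ} (h : k ≤ l) : mbIter 3 k <+: mbIter 3 l := by
  induction h with
  | refl => exact List.prefix_refl _
  | step _ ih => exact ih.trans (mbIter_prefix_succ _)

theorem length_mbSub_pos (x : ℕ) : 0 < (mbSub 3 x).length := by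
  unfold mbSub; split <;> simp

theorem length_le_length_mbApply (w : List ℕ) : w.length ≤ (mbApply 3 w).length := by
  induction w with
  | nil => simp
  | cons x w ih =>
    have := length_mbSub_pos x
    simp only [mbApply, List.flatMap_cons, List.length_append, List.length_cons] at ih ⊢
    omega

theorem length_mbApply_zero_cons (w : List ℕ) : w.length + 2 ≤ (mbApply 3 (0 :: w)).length := by
  have h := length_le_length_mbApply w
  have : mbApply 3 (0 :: w) = 0 :: 1 :: mbApply 3 w := by simp [mbApply, mbSub]
  simp [this, h]

theorem lt_length_mbIter (k : ℕ) : k < (mbIter 3 k).length := by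
  induction k with
  | zero => simp [mbIter]
  | succ k ih =>
    obtain ⟨w, hw⟩ : [0] <+: mbIter 3 k := mbIter_prefix (Nat.zero_le k)
    have h := length_mbApply_zero_cons w
    rw [mbIter_succ]
    rw [← hw] at ih ⊢
    simp only [List.cons_append, List.nil_append, List.length_cons] at ih h ⊢
    omega

/-- The Tribonacci word. -/
def tribLetter (n : ℕ) : ℕ := (mbIter 3 n).getD n 0

theorem getElem?_mbIter {k i : ℕ} (h : i < (mbIter 3 k).length) :
    (mbIter 3 k)[i]? = some (tribLetter i) := by
  have hi := lt_length_mbIter i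
  have key : (mbIter 3 k)[i]? = (mbIter 3 i)[i]? := by
    rcases le_total k i with hki | hki
    · obtain ⟨w, hw⟩ := mbIter_prefix hki
      rw [← hw, List.getElem?_append_left h]
    · obtain ⟨w, hw⟩ := mbIter_prefix hki
      rw [← hw, List.getElem?_append_left hi]
  rw [key, tribLetter, List.getD_eq_getElem?_getD, List.getElem?_eq_getElem hi]
  rfl

theorem mbIter_eq_map (k : ℕ) :
    mbIter 3 k = (List.range (mbIter 3 k).length).map tribLetter := by
  apply List.ext_getElem?
  intro i
  rcases lt_or_ge i (mbIter 3 k).length with h | h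
  · rw [getElem?_mbIter h]
    simp [h]
  · simp [h]

theorem eq_map_of_prefix_mbIter {k : ℕ} {w : List ℕ} (h : w <+: mbIter 3 k) :
    w = (List.range w.length).map tribLetter := by
  have hl := h.length_le
  rw [List.prefix_iff_eq_take, mbIter_eq_map k, ← List.map_take, List.take_range,
    min_eq_left hl] at h
  exact h

theorem mbPrefix_eq_map (n : ℕ) : mbPrefix 3 n = (List.range n).map tribLetter := by
  have h := eq_map_of_prefix_mbIter (List.take_prefix n (mbIter 3 n))
  have hl : ((mbIter 3 n).take n).length = n := by
    simpa using (lt_length_mbIter n).le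
  rwa [hl] at h

theorem mbPrefix_succ (n : ℕ) : mbPrefix 3 (n + 1) = mbPrefix 3 n ++ [tribLetter n] := by
  simp [mbPrefix_eq_map, List.range_succ]

theorem length_mbPrefix (n : ℕ) : (mbPrefix 3 n).length = n := by
  simp [mbPrefix_eq_map]

theorem mbPrefix_add (i n : ℕ) :
    mbPrefix 3 (i + n) = mbPrefix 3 i ++ ((mbPrefix 3 (i + n)).drop i) := by
  have h : mbPrefix 3 i = (mbPrefix 3 (i + n)).take i := by
    simp [mbPrefix_eq_map, ← List.map_take, List.take_range]
  conv_rhs => rw [h]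
  exact (List.take_append_drop i _).symm

theorem mbFactor_iff (w : List ℕ) :
    mbFactor 3 w ↔ ∃ i, mbPrefix 3 (i + w.length) = mbPrefix 3 i ++ w := by
  constructor
  · rintro ⟨k, a, b, h⟩
    refine ⟨a.length, ?_⟩
    have h1 : a ++ w <+: mbIter 3 k := ⟨b, h⟩
    have h2 : a <+: mbIter 3 k := (List.prefix_append a w).trans h1
    have h3 := eq_map_of_prefix_mbIter h1
    have h4 := eq_map_of_prefix_mbIter h2
    rw [mbPrefix_eq_map, mbPrefix_eq_map, ← h4, ← List.length_append, ← h3]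
  · rintro ⟨i, h⟩
    refine ⟨i + w.length, ?_⟩
    have h1 : mbPrefix 3 (i + w.length) <:+: mbIter 3 (i + w.length) :=
      (List.take_prefix _ _).isInfix
    rw [h] at h1
    exact (List.suffix_append _ w).isInfix.trans h1

/-- The length of the image under the substitution of the prefix of length `n`. -/
def imageLength (n : ℕ) : ℕ := (mbApply 3 (mbPrefix 3 n)).length

theorem mbPrefix_imageLength (n : ℕ) :
    mbPrefix 3 (imageLength n) = mbApply 3 (mbPrefix 3 n) := by
  have h : mbApply 3 (mbPrefix 3 n) <+: mbIter 3 (n + 1) := by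
    rw [mbIter_succ]
    exact mbApply_prefix (List.take_prefix _ _)
  rw [mbPrefix_eq_map]
  exact (eq_map_of_prefix_mbIter h).symm

theorem mbPrefix_imageLength_succ (n : ℕ) :
    mbPrefix 3 (imageLength (n + 1)) = mbPrefix 3 (imageLength n) ++ mbSub 3 (tribLetter n) := by
  rw [mbPrefix_imageLength, mbPrefix_imageLength, mbPrefix_succ, mbApply_append]
  simp [mbApply]

theorem imageLength_zero : imageLength 0 = 0 := by
  simp [imageLength, mbPrefix_eq_map, mbApply]

theorem imageLength_succ (n : ℕ) :
    imageLength (n + 1) = imageLength n + (mbSub 3 (tribLetter n)).length := by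
  simpa [length_mbPrefix] using congrArg List.length (mbPrefix_imageLength_succ n)

theorem tribLetter_imageLength_add (n d : ℕ) (h : d < (mbSub 3 (tribLetter n)).length) :
    tribLetter (imageLength n + d) = (mbSub 3 (tribLetter n))[d] := by
  have h1 := congrArg (·[imageLength n + d]?) (mbPrefix_imageLength_succ n)
  simp only [mbPrefix_eq_map, imageLength_succ] at h1
  simpa [h] using h1

/-- The pairs in `imageLetters` are the letters of the image with their offsets. -/
theorem mem_imageLetters {x : ℕ} (hx : x ≤ 2) {p : ℕ × ℕ} :
    p ∈ imageLetters x ↔ (mbSub 3 x)[p.2]? = some p.1 := by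
  obtain ⟨a, d⟩ := p
  interval_cases x <;> rcases d with _ | _ | d <;> simp [imageLetters, mbSub, eq_comm]

theorem length_imageLetters {x : ℕ} (hx : x ≤ 2) :
    (imageLetters x).length = (mbSub 3 x).length := by
  interval_cases x <;> rfl

theorem exists_imageLength_add (n : ℕ) :
    ∃ m d, n = imageLength m + d ∧ d < (mbSub 3 (tribLetter m)).length := by
  induction n with
  | zero => exact ⟨0, 0, by simp [imageLength_zero], length_mbSub_pos _⟩
  | succ n ih =>
    obtain ⟨m, d, rfl, hd⟩ := ih
    by_cases h : d + 1 < (mbSub 3 (tribLetter m)).length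
    · exact ⟨m, d + 1, rfl, h⟩
    · refine ⟨m + 1, 0, ?_, length_mbSub_pos _⟩
      rw [imageLength_succ]
      omega

theorem tribLetter_le_two (n : ℕ) : tribLetter n ≤ 2 := by
  induction n using Nat.strong_induction_on with
  | _ n ih =>
    obtain ⟨m, d, hn, hd⟩ := exists_imageLength_add n
    have hm : m ≤ imageLength m := by
      simpa [imageLength, length_mbPrefix] using length_le_length_mbApply (mbPrefix 3 m)
    rw [hn, tribLetter_imageLength_add m d hd]
    have key : ∀ x, (d ≠ 0 → x ≤ 2) → ∀ h : d < (mbSub 3 x).length, (mbSub 3 x)[d] ≤ 2 := by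
      intro x hx h
      rcases d with _ | d
      · unfold mbSub; split <;> simp
      · have := hx (by simp)
        clear hd
        revert h
        interval_cases x <;> rcases d with _ | d <;> simp [mbSub]
    exact key _ (fun h => ih m (by omega)) hd

/-- Every position lies in the image of a unique earlier letter. -/
theorem exists_imageLetters (n : ℕ) :
    ∃ m, ∃ p ∈ imageLetters (tribLetter m), n = imageLength m + p.2 := by
  obtain ⟨m, d, hn, hd⟩ := exists_imageLength_add n
  exact ⟨m, ((mbSub 3 (tribLetter m))[d], d),
    (mem_imageLetters (tribLetter_le_two m)).2 (List.getElem?_eq_getElem hd), hn⟩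

theorem tribLetter_of_mem_imageLetters {n : ℕ} {p : ℕ × ℕ}
    (hp : p ∈ imageLetters (tribLetter n)) : tribLetter (imageLength n + p.2) = p.1 := by
  rw [mem_imageLetters (tribLetter_le_two n), List.getElem?_eq_some_iff] at hp
  obtain ⟨h, h'⟩ := hp
  rw [tribLetter_imageLength_add n p.2 h, h']

/-- The number of occurrences of a letter in the prefix of length `n`. -/
def prefixCount (l n : ℕ) : ℤ := ((mbPrefix 3 n).count l : ℤ)

theorem prefixCount_zero_right (l : ℕ) : prefixCount l 0 = 0 := by
  simp [prefixCount, mbPrefix_eq_map]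

theorem prefixCount_sum (n : ℕ) :
    prefixCount 0 n + prefixCount 1 n + prefixCount 2 n = n := by
  induction n with
  | zero => simp [prefixCount_zero_right]
  | succ n ih =>
    have h := tribLetter_le_two n
    simp only [prefixCount, mbPrefix_succ, List.count_append] at ih ⊢
    interval_cases tribLetter n <;> simp <;> omega

theorem count_mbApply (w : List ℕ) (hw : ∀ x ∈ w, x ≤ 2) :
    (mbApply 3 w).count 0 = w.count 0 + w.count 1 + w.count 2 ∧
    (mbApply 3 w).count 1 = w.count 0 ∧ (mbApply 3 w).count 2 = w.count 1 := by
  induction w with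
  | nil => simp [mbApply]
  | cons x w ih =>
    obtain ⟨h0, h1, h2⟩ := ih fun y hy => hw y (List.mem_cons_of_mem _ hy)
    have hx := hw x List.mem_cons_self
    simp only [mbApply, List.flatMap_cons, List.count_append] at h0 h1 h2 ⊢
    rw [h0, h1, h2]
    interval_cases x <;> simp [mbSub] <;> omega

theorem prefixCount_imageLength (n : ℕ) :
    prefixCount 0 (imageLength n) = prefixCount 0 n + prefixCount 1 n + prefixCount 2 n ∧
    prefixCount 1 (imageLength n) = prefixCount 0 n ∧
    prefixCount 2 (imageLength n) = prefixCount 1 n := by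
  have hw : ∀ x ∈ mbPrefix 3 n, x ≤ 2 := by
    intro x hx
    rw [mbPrefix_eq_map, List.mem_map] at hx
    obtain ⟨i, -, rfl⟩ := hx
    exact tribLetter_le_two i
  obtain ⟨h0, h1, h2⟩ := count_mbApply _ hw
  simp only [prefixCount, mbPrefix_imageLength, h0, h1, h2]
  simp

/-- The Parikh vector of a prefix in terms of that of its preimage. -/
theorem prefixCount_imageLength_add {n : ℕ} {p : ℕ × ℕ}
    (hp : p ∈ imageLetters (tribLetter n)) :
    prefixCount 0 (imageLength n + p.2) =
      prefixCount 0 n + prefixCount 1 n + prefixCount 2 n + p.2 ∧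
    prefixCount 1 (imageLength n + p.2) = prefixCount 0 n ∧
    prefixCount 2 (imageLength n + p.2) = prefixCount 1 n := by
  obtain ⟨h0, h1, h2⟩ := prefixCount_imageLength n
  have hp' : p.2 = 0 ∨ p.2 = 1 := by
    unfold imageLetters at hp
    split at hp <;> simp at hp
    · rcases hp with rfl | rfl <;> simp
    · simp [hp]
  have h := tribLetter_imageLength_add n 0 (length_mbSub_pos _)
  have h' : tribLetter (imageLength n) = 0 := by
    rw [add_zero] at h
    rw [h]
    unfold mbSub; split <;> simp
  rcases hp' with hp' | hp' <;> rw [hp']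
  · simp [h0, h1, h2]
  · simp only [prefixCount, mbPrefix_succ, h', List.count_append] at h0 h1 h2 ⊢
    simp
    omega

theorem imageLength_eq (n : ℕ) :
    (imageLength n : ℤ) = 2 * prefixCount 0 n + 2 * prefixCount 1 n + prefixCount 2 n := by
  obtain ⟨h0, h1, h2⟩ := prefixCount_imageLength n
  rw [← prefixCount_sum (imageLength n), h0, h1, h2]
  ring

theorem imageLength_strictMono : StrictMono imageLength :=
  strictMono_nat_of_lt_succ fun n => by
    rw [imageLength_succ]
    have := length_mbSub_pos (tribLetter n)
    omega

theorem lt_imageLength {n : ℕ} (hn : 0 < n) : n < imageLength n := by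
  induction n, hn using Nat.le_induction with
  | base => simp [imageLength, mbPrefix, mbIter, mbApply, mbSub]
  | succ n _ ih => exact lt_of_le_of_lt ih (imageLength_strictMono n.lt_succ_self)

end Word

section Masks

theorem testBit_setBits (l : List ℕ) (m j : ℕ) :
    (setBits l m).testBit j ↔ m.testBit j ∨ j ∈ l := by
  induction l generalizing m with
  | nil => simp [setBits]
  | cons i l ih =>
    have h : (Nat.lor m (Nat.shiftLeft 1 i)).testBit j = (m ||| 1 <<< i).testBit j := rfl
    rw [setBits, ih, h, Nat.testBit_or, Nat.one_shiftLeft, Nat.testBit_two_pow,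
      Bool.or_eq_true, decide_eq_true_eq, List.mem_cons, or_assoc, eq_comm (a := i)]

theorem testBit_imageMask (F : List (List ℕ)) (m j : ℕ) :
    (imageMask F m).testBit j ↔ ∃ i l, F[i]? = some l ∧ m.testBit i ∧ j ∈ l := by
  induction F generalizing m with
  | nil => simp [imageMask]
  | cons l F ih =>
    have h0 : m.testBit 0 = Nat.beq (Nat.mod m 2) 1 := by
      rw [Nat.testBit_zero, Bool.eq_iff_iff, decide_eq_true_eq, Nat.beq_eq]
      rfl
    have hs : ∀ i, m.testBit (i + 1) = (Nat.div m 2).testBit i := fun i => Nat.testBit_succ m i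
    have key : (∃ i l', (l :: F)[i]? = some l' ∧ m.testBit i ∧ j ∈ l') ↔
        (m.testBit 0 ∧ j ∈ l) ∨ ∃ i l', F[i]? = some l' ∧ (Nat.div m 2).testBit i ∧ j ∈ l' := by
      constructor
      · rintro ⟨_ | i, l', h1, h2, h3⟩
        · simp only [List.getElem?_cons_zero, Option.some.injEq] at h1
          exact Or.inl ⟨h2, h1 ▸ h3⟩
        · exact Or.inr ⟨i, l', by simpa using h1, hs i ▸ h2, h3⟩
      · rintro (⟨h2, h3⟩ | ⟨i, l', h1, h2, h3⟩)
        · exact ⟨0, l, rfl, h2, h3⟩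
        · exact ⟨i + 1, l', by simpa using h1, (hs i).symm ▸ h2, h3⟩
    rw [key, ← ih, imageMask, ← h0]
    cases m.testBit 0 <;> simp [testBit_setBits, or_comm]

theorem decodeMask_imageMask {α β : Type*} {F : List (List ℕ)} {U : List α} {V : List β}
    {φ : α → List β} (h : Represents F U V φ) (m : ℕ) :
    decodeMask V (imageMask F m) = {v | ∃ s ∈ decodeMask U m, v ∈ φ s} := by
  have hrow : ∀ i : ℕ, (F[i]?).map (fun l => l.map (V[·]?)) =
      (U[i]?).map (fun s => (φ s).map some) := by
    intro i
    simpa only [List.getElem?_map] using congrArg (·[i]?) h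
  ext v
  simp only [decodeMask, Set.mem_ofPred_eq, testBit_imageMask]
  constructor
  · rintro ⟨j, hj, i, l, hl, hm, hjl⟩
    have hi := hrow i
    rw [hl] at hi
    rcases hU : U[i]? with _ | s
    · simp [hU] at hi
    · rw [hU] at hi
      simp only [Option.map_some, Option.some.injEq] at hi
      refine ⟨s, ⟨i, hU, hm⟩, ?_⟩
      have : some v ∈ (φ s).map some := by
        rw [← hi, ← hj]
        exact List.mem_map_of_mem hjl
      simpa using this
  · rintro ⟨s, ⟨i, hU, hm⟩, hv⟩
    have hi := hrow i
    rw [hU] at hi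
    rcases hF : F[i]? with _ | l
    · simp [hF] at hi
    · rw [hF] at hi
      simp only [Option.map_some, Option.some.injEq] at hi
      have : some v ∈ l.map (V[·]?) := by
        rw [hi]
        exact List.mem_map_of_mem hv
      obtain ⟨j, hjl, hj⟩ := List.mem_map.1 this
      exact ⟨j, hj, i, l, hF, hm, hjl⟩

theorem decodeMask_subset {α : Type*} (V : List α) (m : ℕ) : decodeMask V m ⊆ {v | v ∈ V} := by
  rintro v ⟨i, hi, -⟩
  exact List.mem_of_getElem? hi

theorem represents_comparisonEdges {d : ℕ} (hd : d ≤ 1) :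
    Represents (comparisonEdges d) comparisonStates comparisonStates (comparisonSucc d) := by
  interval_cases d
  · exact represents_edgesZero
  · exact represents_edgesOne

end Masks

section Comparison

/-- The comparison state of two positions and a length. -/
def comparisonState (n i j : ℕ) : ComparisonState :=
  (tribLetter i, tribLetter j, prefixCount 0 j - prefixCount 0 i - prefixCount 0 n,
    prefixCount 1 j - prefixCount 1 i - prefixCount 1 n,
    prefixCount 2 j - prefixCount 2 i - prefixCount 2 n)

/-- The comparison states of a length. -/
def comparisonSet (n : ℕ) : Set ComparisonState :=
  {s | ∃ i j, i + n ≤ j + 1 ∧ j ≤ i + n + 3 ∧ s = comparisonState n i j}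

theorem offset_le_one {x : ℕ} {p : ℕ × ℕ} (hp : p ∈ imageLetters x) : p.2 ≤ 1 := by
  unfold imageLetters at hp
  split at hp <;> simp at hp
  · rcases hp with rfl | rfl <;> simp
  · simp [hp]

theorem comparisonState_sum (n i j : ℕ) :
    (comparisonState n i j).2.2.1 + (comparisonState n i j).2.2.2.1 +
      (comparisonState n i j).2.2.2.2 = (j : ℤ) - i - n := by
  have h1 := prefixCount_sum i
  have h2 := prefixCount_sum j
  have h3 := prefixCount_sum n
  simp only [comparisonState]
  linarith

theorem comparisonState_imageLength (n i j : ℕ) :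
    2 * (comparisonState n i j).2.2.1 + 2 * (comparisonState n i j).2.2.2.1 +
      (comparisonState n i j).2.2.2.2 =
        (imageLength j : ℤ) - imageLength i - imageLength n := by
  simp only [comparisonState, imageLength_eq]
  ring

/-- The successors of a comparison state are the comparison states of the image positions. -/
theorem mem_comparisonSucc {n i j : ℕ} {p : ℕ × ℕ} (hp : p ∈ imageLetters (tribLetter n))
    {s : ComparisonState} :
    s ∈ comparisonSucc p.2 (comparisonState n i j) ↔
      ∃ q ∈ imageLetters (tribLetter i), ∃ r ∈ imageLetters (tribLetter j),
        imageLength i + q.2 + (imageLength n + p.2) ≤ imageLength j + r.2 + 1 ∧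
        imageLength j + r.2 ≤ imageLength i + q.2 + (imageLength n + p.2) + 3 ∧
        s = comparisonState (imageLength n + p.2) (imageLength i + q.2) (imageLength j + r.2) := by
  simp only [comparisonSucc, List.mem_flatMap]
  refine exists_congr fun q => and_congr_right fun hq =>
    exists_congr fun r => and_congr_right fun hr => ?_
  obtain ⟨hp0, hp1, hp2⟩ := prefixCount_imageLength_add hp
  obtain ⟨hq0, hq1, hq2⟩ := prefixCount_imageLength_add hq
  obtain ⟨hr0, hr1, hr2⟩ := prefixCount_imageLength_add hr
  have hs := comparisonState_sum (imageLength n + p.2) (imageLength i + q.2) (imageLength j + r.2)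
  have hstate : comparisonState (imageLength n + p.2) (imageLength i + q.2)
      (imageLength j + r.2) = (q.1, r.1,
        (comparisonState n i j).2.2.1 + (comparisonState n i j).2.2.2.1 +
          (comparisonState n i j).2.2.2.2 + r.2 - q.2 - p.2,
        (comparisonState n i j).2.2.1, (comparisonState n i j).2.2.2.1) := by
    simp only [comparisonState, tribLetter_of_mem_imageLetters hq,
      tribLetter_of_mem_imageLetters hr, hp0, hp1, hp2, hq0, hq1, hq2, hr0, hr1, hr2,
      Prod.mk.injEq, true_and, and_true]
    ring
  rw [hstate] at hs ⊢
  simp only at hs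
  push_cast at hs
  rw [hs]
  split_ifs with h
  · simp only [List.mem_singleton]
    constructor
    · exact fun h' => ⟨by omega, by omega, h'⟩
    · exact fun h' => h'.2.2
  · simp only [List.not_mem_nil, false_iff]
    rintro ⟨h1, h2, -⟩
    exact h ⟨by omega, by omega⟩

theorem mem_comparisonSet_of_imageLength {n i j : ℕ}
    (hn : ∀ j, i + n ≤ j + 1 → j ≤ i + n + 3 → comparisonState n i j ∈ comparisonStates)
    {p q r : ℕ × ℕ} (hp : p ∈ imageLetters (tribLetter n))
    (hq : q ∈ imageLetters (tribLetter i)) (hr : r ∈ imageLetters (tribLetter j))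
    (h1 : imageLength i + q.2 + (imageLength n + p.2) ≤ imageLength j + r.2 + 1)
    (h2 : imageLength j + r.2 ≤ imageLength i + q.2 + (imageLength n + p.2) + 3) :
    i + n ≤ j + 1 ∧ j ≤ i + n + 3 := by
  have hp' := offset_le_one hp
  constructor
  · by_contra! hlt
    obtain ⟨k, hk⟩ : ∃ k, i + n = k + 1 := ⟨i + n - 1, by omega⟩
    obtain ⟨-, hexp⟩ := comparisonStates_expanding _ (hn k (by omega) (by omega))
    rw [comparisonState_sum, comparisonState_imageLength] at hexp
    have hexp := hexp (by push_cast [← @Nat.cast_inj ℤ] at hk; omega)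
    have hmono : imageLength (j + 1) ≤ imageLength k :=
      imageLength_strictMono.monotone (by omega)
    have hr' : r.2 < (mbSub 3 (tribLetter j)).length := by
      rw [mem_imageLetters (tribLetter_le_two j)] at hr
      exact (List.getElem?_eq_some_iff.1 hr).1
    rw [imageLength_succ] at hmono
    omega
  · by_contra! hlt
    obtain ⟨hexp, -⟩ :=
      comparisonStates_expanding _ (hn (i + n + 3) (by omega) (by omega))
    rw [comparisonState_sum, comparisonState_imageLength] at hexp
    have hexp := hexp (by push_cast; omega) q hq
    have hmono : imageLength (i + n + 3 + 1) ≤ imageLength j :=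
      imageLength_strictMono.monotone (by omega)
    rw [imageLength_succ, ← length_imageLetters (tribLetter_le_two _)] at hmono
    simp only [comparisonState] at hexp
    omega

theorem comparisonSet_imageLength {n : ℕ} (hn : comparisonSet n ⊆ {s | s ∈ comparisonStates})
    {p : ℕ × ℕ} (hp : p ∈ imageLetters (tribLetter n)) :
    comparisonSet (imageLength n + p.2) =
      {s | ∃ s' ∈ comparisonSet n, s ∈ comparisonSucc p.2 s'} := by
  ext s
  constructor
  · rintro ⟨i', j', h1, h2, rfl⟩
    obtain ⟨i, q, hq, rfl⟩ := exists_imageLetters i'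
    obtain ⟨j, r, hr, rfl⟩ := exists_imageLetters j'
    obtain ⟨h3, h4⟩ := mem_comparisonSet_of_imageLength
      (fun j h3 h4 => hn ⟨i, j, h3, h4, rfl⟩) hp hq hr h1 h2
    exact ⟨_, ⟨i, j, h3, h4, rfl⟩, (mem_comparisonSucc hp).2 ⟨q, hq, r, hr, h1, h2, rfl⟩⟩
  · rintro ⟨_, ⟨i, j, h3, h4, rfl⟩, hs⟩
    obtain ⟨q, hq, r, hr, h1, h2, rfl⟩ := (mem_comparisonSucc hp).1 hs
    exact ⟨_, _, h1, h2, rfl⟩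

theorem zero_mem_imageLetters (x : ℕ) : (0, 0) ∈ imageLetters x := by
  unfold imageLetters; split <;> simp

theorem comparisonSucc_initialMask {s s' : ComparisonState}
    (hs : s ∈ decodeMask comparisonStates (subsetMask 0)) (hs' : s' ∈ comparisonSucc 0 s) :
    s' ∈ decodeMask comparisonStates (subsetMask 0) := by
  rw [← imageMask_initial, decodeMask_imageMask (represents_comparisonEdges zero_le_one)]
  exact ⟨s, hs, hs'⟩

theorem comparisonState_zero : comparisonState 0 0 0 = (0, 0, 0, 0, 0) := by
  simp [comparisonState, prefixCount_zero_right, tribLetter, mbIter]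

theorem comparisonState_zero_mem (i j : ℕ) (h1 : i ≤ j + 1) (h2 : j ≤ i + 3) :
    comparisonState 0 i j ∈ decodeMask comparisonStates (subsetMask 0) := by
  induction i using Nat.strong_induction_on generalizing j with
  | _ i ihi =>
  induction j using Nat.strong_induction_on with
  | _ j ihj =>
    by_cases h0 : i = 0 ∧ j = 0
    · rw [h0.1, h0.2, comparisonState_zero]
      exact ⟨0, by decide, by decide +kernel⟩
    obtain ⟨i', q, hq, hi⟩ := exists_imageLetters i
    obtain ⟨j', r, hr, hj⟩ := exists_imageLetters j
    have hp := zero_mem_imageLetters (tribLetter 0)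
    have hlt : ∀ m, 0 < m → m < imageLength m := fun m hm => lt_imageLength hm
    have hi' : i' ≤ i ∧ (0 < i → i' < i) := by
      rcases Nat.eq_zero_or_pos i' with h | h
      · omega
      · have := hlt i' h
        omega
    have hj' : j' ≤ j ∧ (0 < j → j' < j) := by
      rcases Nat.eq_zero_or_pos j' with h | h
      · omega
      · have := hlt j' h
        omega
    have hrange : i' ≤ j' + 1 ∧ j' ≤ i' + 3 := by
      rcases Nat.eq_zero_or_pos i with h | h
      · omega
      · refine mem_comparisonSet_of_imageLength (n := 0) (fun l h3 h4 => ?_) hp hq hr ?_ ?_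
        · exact decodeMask_subset _ _ (ihi i' (hi'.2 h) l h3 h4)
        · simpa [imageLength_zero, ← hi, ← hj] using h1
        · simpa [imageLength_zero, ← hi, ← hj] using h2
    have hmem : comparisonState 0 i' j' ∈ decodeMask comparisonStates (subsetMask 0) := by
      rcases Nat.eq_zero_or_pos i with h | h
      · obtain rfl : i' = i := by omega
        exact ihj j' (hj'.2 (by omega)) hrange.1 hrange.2
      · exact ihi i' (hi'.2 h) j' hrange.1 hrange.2
    refine comparisonSucc_initialMask hmem ((mem_comparisonSucc hp).2 ⟨q, hq, r, hr, ?_, ?_, ?_⟩)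
    · simpa [imageLength_zero, ← hi, ← hj] using h1
    · simpa [imageLength_zero, ← hi, ← hj] using h2
    · simp [imageLength_zero, ← hi, ← hj]

end Comparison

section Automaton

theorem comparisonSet_zero :
    comparisonSet 0 = decodeMask comparisonStates (subsetMask 0) := by
  apply Set.Subset.antisymm
  · rintro _ ⟨i, j, h1, h2, rfl⟩
    exact comparisonState_zero_mem i j h1 h2
  · have hclosed : ∀ s ∈ comparisonSet 0, ∀ s' ∈ comparisonSucc 0 s, s' ∈ comparisonSet 0 := by
      rintro _ ⟨i, j, -, -, rfl⟩ s' hs'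
      obtain ⟨q, -, r, -, h1, h2, rfl⟩ :=
        (mem_comparisonSucc (zero_mem_imageLetters (tribLetter 0))).1 hs'
      simp only [imageLength_zero, Nat.add_zero] at h1 h2 ⊢
      exact ⟨_, _, h1, h2, rfl⟩
    have hiter : ∀ k : ℕ, decodeMask comparisonStates
        ((fun m => m ||| imageMask (comparisonEdges 0) m)^[k] 1) ⊆ comparisonSet 0 := by
      intro k
      induction k with
      | zero =>
        rintro s ⟨i, hi, hbit⟩
        have hbit : (2 ^ 0).testBit i := hbit
        rw [Nat.testBit_two_pow, decide_eq_true_eq] at hbit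
        subst hbit
        have hs : s = comparisonState 0 0 0 := by
          rw [comparisonState_zero]
          exact (Option.some.inj hi).symm
        exact ⟨0, 0, by simp, by simp, hs⟩
      | succ k ih =>
        rw [Function.iterate_succ_apply']
        rintro s ⟨i, hi, hbit⟩
        rw [Nat.testBit_or, Bool.or_eq_true] at hbit
        rcases hbit with hbit | hbit
        · exact ih ⟨i, hi, hbit⟩
        · have hs : s ∈ decodeMask comparisonStates (imageMask (comparisonEdges 0) _) :=
            ⟨i, hi, hbit⟩
          rw [decodeMask_imageMask (represents_comparisonEdges zero_le_one)] at hs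
          obtain ⟨s', hs', hss'⟩ := hs
          exact hclosed s' (ih hs') s hss'
    rw [← initialMask_eq]
    exact hiter 28

/-- The state `q` of the subset automaton describes the length `n`. -/
def Describes (n q : ℕ) : Prop :=
  q < 309 ∧ comparisonSet n = decodeMask comparisonStates (subsetMask q) ∧
    tribLetter n = subsetLetter q

theorem describes_zero : Describes 0 0 :=
  ⟨by simp, comparisonSet_zero, by decide⟩

theorem subsetStepCheck_of_mem {n q : ℕ} (h : Describes n q) {p : ℕ × ℕ}
    (hp : p ∈ imageLetters (tribLetter n)) : subsetStepCheck q p.2 := by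
  have hall := List.all_eq_true.1 subsetStepCheck_all q (List.mem_range.2 h.1)
  simp only [Bool.and_eq_true, Bool.or_eq_true, Nat.ble_eq] at hall
  obtain ⟨⟨⟨h0, h1⟩, -⟩, -⟩ := hall
  rw [h.2.2] at hp
  unfold imageLetters at hp
  split_ifs at hp with hlt <;> simp at hp
  · rcases hp with rfl | rfl
    · exact h0
    · exact h1.resolve_left (by omega)
  · rw [hp]
    exact h0

theorem Describes.step {n q : ℕ} (h : Describes n q) {p : ℕ × ℕ}
    (hp : p ∈ imageLetters (tribLetter n)) :
    Describes (imageLength n + p.2) (subsetNext q p.2) := by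
  have hc := subsetStepCheck_of_mem h hp
  simp only [subsetStepCheck, Bool.and_eq_true, Nat.beq_eq, Nat.blt_eq] at hc
  obtain ⟨⟨⟨h1, h2⟩, h3⟩, -⟩ := hc
  have hsub : comparisonSet n ⊆ {s | s ∈ comparisonStates} := by
    rw [h.2.1]
    exact decodeMask_subset _ _
  refine ⟨h1, ?_, ?_⟩
  · rw [comparisonSet_imageLength hsub hp, h.2.1, h2,
      decodeMask_imageMask (represents_comparisonEdges (offset_le_one hp))]
  · rw [tribLetter_of_mem_imageLetters hp, h3, ← h.2.2]
    unfold imageLetters at hp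
    split at hp <;> simp at hp
    · rcases hp with rfl | rfl <;> simp
    · simp [hp]

theorem Describes.subsetClass_step {n q : ℕ} (h : Describes n q) {p : ℕ × ℕ}
    (hp : p ∈ imageLetters (tribLetter n)) :
    subsetClass (subsetNext q p.2) = reducedNext (subsetClass q) p.2 := by
  have hc := subsetStepCheck_of_mem h hp
  simp only [subsetStepCheck, Bool.and_eq_true, Nat.beq_eq] at hc
  exact hc.2

theorem Describes.subsetClass_lt {n q : ℕ} (h : Describes n q) : subsetClass q < 77 := by
  have hall := List.all_eq_true.1 subsetStepCheck_all q (List.mem_range.2 h.1)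
  simp only [Bool.and_eq_true, Nat.blt_eq] at hall
  exact hall.1.2

/-- The function on letters with the given values. -/
def vectorOf (v : ℤ × ℤ × ℤ) : Fin 3 → ℤ := ![v.1, v.2.1, v.2.2]

/-- The output of the reduced automaton. -/
def reducedOutput (c : ℕ) : Set (Fin 3 → ℤ) :=
  vectorOf '' decodeMask balancedVectors (reducedRow c).2.2

theorem reducedOutput_finite (c : ℕ) : (reducedOutput c).Finite :=
  ((List.finite_toSet balancedVectors).subset (decodeMask_subset _ _)).image _

theorem relParikhSetT_eq (n : ℕ) :
    relParikhSetT n =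
      vectorOf '' {v | ∃ s ∈ comparisonSet n, v ∈ balancedVector s} := by
  have hcount : ∀ (w : List ℕ) (i : ℕ), mbPrefix 3 (i + w.length) = mbPrefix 3 i ++ w →
      ∀ l, (w.count l : ℤ) = prefixCount l (i + w.length) - prefixCount l i := by
    intro w i h l
    simp [prefixCount, h]
  have hvec : ∀ i, vectorOf (comparisonState n i (i + n)).2.2 = fun l : Fin 3 =>
      prefixCount l (i + n) - prefixCount l i - prefixCount l n := by
    intro i
    funext l
    fin_cases l <;> rfl
  ext p
  constructor
  · rintro ⟨w, hw, rfl, hp⟩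
    obtain ⟨i, hi⟩ := (mbFactor_iff w).1 hw
    refine ⟨_, ⟨_, ⟨i, i + w.length, by omega, by omega, rfl⟩, ?_⟩, (hvec i).trans ?_⟩
    · rw [balancedVector, comparisonState_sum, if_pos (by push_cast; ring)]
      exact List.mem_singleton_self _
    · funext l
      rw [hp l, hcount w i hi]
      rfl
  · rintro ⟨v, ⟨_, ⟨i, j, -, -, rfl⟩, hv⟩, rfl⟩
    rw [balancedVector, comparisonState_sum] at hv
    split_ifs at hv with hsum
    · rw [List.mem_singleton] at hv
      obtain rfl : j = i + n := by omega
      have hlen : ((mbPrefix 3 (i + n)).drop i).length = n := by simp [length_mbPrefix]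
      have hpre : mbPrefix 3 (i + ((mbPrefix 3 (i + n)).drop i).length) =
          mbPrefix 3 i ++ (mbPrefix 3 (i + n)).drop i := by
        rw [hlen]
        exact mbPrefix_add i n
      refine ⟨_, (mbFactor_iff _).2 ⟨i, hpre⟩, hlen, fun l => ?_⟩
      rw [hcount _ i hpre, hlen, hv, hvec]
      rfl
    · simp at hv

theorem Describes.relParikhSetT_eq {n q : ℕ} (h : Describes n q) :
    relParikhSetT n = reducedOutput (subsetClass q) := by
  have hall := List.all_eq_true.1 subsetStepCheck_all q (List.mem_range.2 h.1)
  simp only [Bool.and_eq_true, Nat.beq_eq] at hall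
  rw [_root_.relParikhSetT_eq, reducedOutput, hall.2,
    decodeMask_imageMask represents_balancedIndices, h.2.1]

theorem exists_describes (n : ℕ) : ∃ q, Describes n q := by
  induction n using Nat.strong_induction_on with
  | _ n ih =>
    obtain ⟨m, p, hp, rfl⟩ := exists_imageLetters n
    rcases Nat.eq_zero_or_pos (imageLength m + p.2) with h | h
    · exact ⟨0, h ▸ describes_zero⟩
    · have hm : m < imageLength m + p.2 := by
        rcases Nat.eq_zero_or_pos m with h' | h'
        · omega
        · have := lt_imageLength h'
          omega
      obtain ⟨q, hq⟩ := ih m hm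
      exact ⟨_, hq.step hp⟩

end Automaton

section Digits

/-- The value of a digit string with respect to a shift of the Tribonacci numbers. -/
def shiftedValT (k : ℕ) : List ℕ → ℕ
  | [] => 0
  | d :: L => d * tribN (L.length + k) + shiftedValT k L

theorem shiftedValT_three (L : List ℕ) : shiftedValT 3 L = valT L := by
  induction L with
  | nil => rfl
  | cons d L ih => simp [shiftedValT, valT, ih]

theorem shiftedValT_append (k : ℕ) (L : List ℕ) (d : ℕ) :
    shiftedValT k (L ++ [d]) = shiftedValT (k + 1) L + d * tribN k := by
  induction L with
  | nil => simp [shiftedValT]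
  | cons e L ih =>
    simp only [List.cons_append, shiftedValT, ih, List.length_append, List.length_singleton]
    rw [show L.length + 1 + k = L.length + (k + 1) by ring]
    ring

theorem tribN_add_three (k : ℕ) : tribN (k + 3) = tribN (k + 2) + tribN (k + 1) + tribN k := rfl

theorem shiftedValT_add_three (k : ℕ) (L : List ℕ) :
    shiftedValT (k + 3) L = shiftedValT (k + 2) L + shiftedValT (k + 1) L + shiftedValT k L := by
  induction L with
  | nil => rfl
  | cons d L ih =>
    simp only [shiftedValT, ih, ← add_assoc, tribN_add_three]
    ring

theorem not_infix_of_isNormalTRep {n : ℕ} {L : List ℕ} (h : IsNormalTRep n L) :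
    ¬ [1, 1, 1] <:+: L := by
  rintro ⟨P, Q, rfl⟩
  have hS := h.2.2.2 ([1, 1, 1] ++ Q) ⟨P, by simp⟩
  have h6 := tribN_add_three (Q.length + 3)
  simp only [List.cons_append, List.nil_append, valT, List.length_cons, one_mul, add_assoc,
    Nat.reduceAdd] at hS h6
  omega

/-- Reading a digit string without three consecutive ones. -/
theorem describes_foldl (L : List ℕ) (hL : ∀ d ∈ L, d ≤ 1) (hinf : ¬ [1, 1, 1] <:+: L) :
    Describes (valT L) (L.foldl subsetNext 0) ∧
    subsetClass (L.foldl subsetNext 0) = L.foldl reducedNext 0 ∧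
    (∀ k, tribLetter (valT L) = k → List.replicate k 1 <:+ L) ∧
    prefixCount 0 (valT L) = shiftedValT 2 L ∧ prefixCount 1 (valT L) = shiftedValT 1 L ∧
    prefixCount 2 (valT L) = shiftedValT 0 L := by
  induction L using List.reverseRecOn with
  | nil =>
    refine ⟨describes_zero, by decide, ?_, ?_⟩
    · rintro k rfl
      simp [valT, tribLetter, mbIter]
    · simp [valT, prefixCount_zero_right, shiftedValT]
  | append_singleton L d ih =>
    obtain ⟨hdes, hcls, hrep, h0, h1, h2⟩ :=
      ih (fun e he => hL e (by simp [he])) (fun h => hinf (h.trans (List.infix_append' [] L [d])))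
    have hd : d ≤ 1 := hL d (by simp)
    have hp : ((if d = 0 then 0 else tribLetter (valT L) + 1), d) ∈
        imageLetters (tribLetter (valT L)) := by
      have hle := tribLetter_le_two (valT L)
      interval_cases d
      · exact zero_mem_imageLetters _
      · have hne : tribLetter (valT L) ≠ 2 := by
          intro h
          obtain ⟨P, rfl⟩ := hrep 2 h
          exact hinf ⟨P, [], by simp [List.replicate]⟩
        have hlt : tribLetter (valT L) < 2 := by omega
        simp [imageLetters, hlt]
    obtain ⟨g0, g1, g2⟩ := prefixCount_imageLength_add hp
    have hsum := prefixCount_sum (imageLength (valT L) + d)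
    have hval : valT (L ++ [d]) = imageLength (valT L) + d := by
      have e : valT (L ++ [d]) = shiftedValT 3 L + shiftedValT 2 L + shiftedValT 1 L + d := by
        rw [← shiftedValT_three, shiftedValT_append, shiftedValT_add_three 1]
        simp [tribN]
      have e3 := shiftedValT_add_three 0 L
      simp only [zero_add] at e3
      simp only at g0 g1 g2
      rw [g0, g1, g2, h0, h1, h2] at hsum
      omega
    refine ⟨?_, ?_, ?_, ?_, ?_, ?_⟩
    · rw [hval, List.foldl_append]
      exact hdes.step hp
    · rw [List.foldl_append, List.foldl_append, ← hcls]
      exact hdes.subsetClass_step hp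
    · rintro k rfl
      rw [hval, tribLetter_of_mem_imageLetters hp]
      interval_cases d
      · simp
      · obtain ⟨P, hP⟩ := hrep _ rfl
        refine ⟨P, ?_⟩
        conv_rhs => rw [← hP]
        simp [List.replicate_succ']
    · rw [hval, g0, h0, h1, h2, shiftedValT_append, shiftedValT_add_three 0]
      simp [tribN]
    · rw [hval, g1, h0, shiftedValT_append]
      simp [tribN]
    · rw [hval, g2, h1, shiftedValT_append]
      simp [tribN]

end Digits

theorem reducedNext_lt {c d : ℕ} (hc : c < 77) (hd : d ≤ 1) : reducedNext c d < 77 := by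
  have hall := List.all_eq_true.1 reducedNext_all c (List.mem_range.2 hc)
  simp only [Bool.and_eq_true, Nat.blt_eq] at hall
  interval_cases d
  · exact hall.1
  · exact hall.2

/-- The transition function of the reduced automaton on its finite set of states. -/
def reducedDelta (c : Fin 77) (d : Fin 2) : Fin 77 :=
  ⟨reducedNext c d, reducedNext_lt c.2 (by omega)⟩

theorem coe_foldl_reducedDelta (L : List ℕ) (hL : ∀ d ∈ L, d ≤ 1) (c : Fin 77) :
    ((L.foldl (fun q d => reducedDelta q (if d = 0 then 0 else 1)) c : Fin 77) : ℕ) =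
      L.foldl reducedNext c := by
  induction L generalizing c with
  | nil => rfl
  | cons d L ih =>
    have hd : d ≤ 1 := hL d List.mem_cons_self
    rw [List.foldl_cons, List.foldl_cons, ih (fun e he => hL e (List.mem_cons_of_mem _ he))]
    interval_cases d <;> rfl

theorem tribonacci_relative_parikh_automaton :
    (∃ k : ℕ, 1 ≤ k ∧ k ≤ 278 ∧
      ∃ (δ : Fin k → Fin 2 → Fin k) (q0 : Fin k) (τ : Fin k → Set (Fin 3 → ℤ)),
        (∀ q, (τ q).Finite) ∧
        ∀ n : ℕ, 1 ≤ n → ∀ L : List ℕ, IsNormalTRep n L →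
          τ (L.foldl (fun q d => δ q (if d = 0 then 0 else 1)) q0) = relParikhSetT n) ∧
    {S : Set (Fin 3 → ℤ) | ∃ n : ℕ, 1 ≤ n ∧ relParikhSetT n = S}.Finite := by
  refine ⟨⟨77, by norm_num, by norm_num, reducedDelta, 0, fun q => reducedOutput q,
    fun q => reducedOutput_finite q, fun n _ L hL => ?_⟩, ?_⟩
  · obtain ⟨hdes, hcls, -⟩ := describes_foldl L hL.1 (not_infix_of_isNormalTRep hL)
    beta_reduce
    rw [coe_foldl_reducedDelta L hL.1, ← hL.2.2.1, hdes.relParikhSetT_eq, hcls]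
    rfl
  · refine (Set.finite_range fun c : Fin 77 => reducedOutput c).subset ?_
    rintro _ ⟨n, -, rfl⟩
    obtain ⟨q, hq⟩ := exists_describes n
    exact ⟨⟨subsetClass q, hq.subsetClass_lt⟩, hq.relParikhSetT_eq.symm⟩
end

section
/- Let t be the Tribonacci word with substitution σ, let n ≥ 1, and let K_0 be the least nonnegative integer with n ≤ |σ^{K_0}(0)|. Then for every integer K with n ≤ |σ^K(0)|, the word σ^{K+3}(0) can be written as a concatenation z_0 z_1 ⋯ z_h of words such that {z_0, z_1, …, z_h} = {σ^{K_0+1}(0), σ^{K_0+1}(1), σ^{K_0+1}(2)} (each of the three words occurring among the blocks), and the prefix t_[n] of t of length n is a prefix of every block z_i. -/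
/-- σ_m^k applied to an arbitrary word. -/
def mbIterW (m k : ℕ) (w : List ℕ) : List ℕ := (mbApply m)^[k] w

theorem mbIterW_eq_flatMap (m k : ℕ) (w : List ℕ) :
    mbIterW m k w = w.flatMap fun a => mbIterW m k [a] := by
  induction k generalizing w with
  | zero => simp [mbIterW]
  | succ k ih =>
    have hsucc (u : List ℕ) : mbIterW m (k + 1) u = mbIterW m k (mbApply m u) :=
      Function.iterate_succ_apply _ _ _
    simp only [hsucc]
    rw [ih, mbApply, List.flatMap_assoc]
    congr 1
    funext a
    rw [← ih]
    simp [mbApply]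

theorem mbIterW_append (m k : ℕ) (u v : List ℕ) :
    mbIterW m k (u ++ v) = mbIterW m k u ++ mbIterW m k v := by
  rw [mbIterW_eq_flatMap, List.flatMap_append, ← mbIterW_eq_flatMap, ← mbIterW_eq_flatMap]

theorem mbIter_add (m j k : ℕ) : mbIter m (j + k) = mbIterW m j (mbIter m k) :=
  Function.iterate_add_apply _ _ _ _

theorem mbIter_prefix_mbIterW_succ (m k a : ℕ) : mbIter m k <+: mbIterW m (k + 1) [a] := by
  obtain ⟨v, hv⟩ : ∃ v, mbApply m [a] = [0] ++ v := by
    by_cases h : a = m - 1 <;> simp [mbApply, mbSub, h]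
  refine ⟨mbIterW m k v, ?_⟩
  rw [show mbIterW m (k + 1) [a] = mbIterW m k (mbApply m [a]) from
    Function.iterate_succ_apply _ _ _, hv]
  exact (mbIterW_append m k [0] v).symm

theorem mbIter_prefix_of_le (m : ℕ) {j k : ℕ} (h : j ≤ k) : mbIter m j <+: mbIter m k := by
  induction k, h using Nat.le_induction with
  | base => exact List.prefix_rfl
  | succ k _ ih => exact ih.trans (mbIter_prefix_mbIterW_succ m k 0)

theorem mbPrefix_prefix_mbIter (m : ℕ) {n k : ℕ} (h : n ≤ (mbIter m k).length) :
    mbPrefix m n <+: mbIter m k :=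
  List.prefix_of_prefix_length_le
    ((List.take_prefix _ _).trans (mbIter_prefix_of_le m (le_max_left n k)))
    (mbIter_prefix_of_le m (le_max_right n k))
    ((List.length_take_le _ _).trans h)

theorem mem_mbIter_three_add_two (j a : ℕ) :
    a ∈ mbIter 3 (j + 2) ↔ a = 0 ∨ a = 1 ∨ a = 2 := by
  induction j generalizing a with
  | zero => simp [mbIter, mbApply, mbSub]; tauto
  | succ j ih =>
    have hsucc : mbIter 3 (j + 1 + 2) = mbApply 3 (mbIter 3 (j + 2)) :=
      Function.iterate_succ_apply' _ _ _
    simp [hsucc, mbApply, ih, mbSub]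
    tauto

theorem tribonacci_block_decomposition (n : ℕ) (hn : 1 ≤ n) (K0 : ℕ)
    (hK0 : IsLeast {k : ℕ | n ≤ (mbIter 3 k).length} K0)
    (K : ℕ) (hK : n ≤ (mbIter 3 K).length) :
    ∃ zs : List (List ℕ), zs ≠ [] ∧ zs.flatten = mbIter 3 (K + 3) ∧
      {z | z ∈ zs} =
        ({mbIterW 3 (K0 + 1) [0], mbIterW 3 (K0 + 1) [1], mbIterW 3 (K0 + 1) [2]} :
          Set (List ℕ)) ∧
      ∀ z ∈ zs, mbPrefix 3 n <+: z := by
  have hle : K0 ≤ K := hK0.2 hK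
  refine ⟨(mbIter 3 (K - K0 + 2)).map fun a => mbIterW 3 (K0 + 1) [a], ?_, ?_, ?_, ?_⟩
  · have h := (mem_mbIter_three_add_two (K - K0) 0).2 (Or.inl rfl)
    simpa using List.ne_nil_of_mem h
  · rw [← List.flatMap_def, ← mbIterW_eq_flatMap, ← mbIter_add]
    congr 1
    omega
  · ext z
    simp [mem_mbIter_three_add_two, eq_comm]
  · intro z hz
    obtain ⟨a, -, rfl⟩ := List.mem_map.1 hz
    exact (mbPrefix_prefix_mbIter 3 hK0.1).trans (mbIter_prefix_mbIterW_succ 3 K0 a)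
end
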